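/- arXiv:1205.5314 — 2 statements merged into one kernel-verified Lean document; each statement's English description precedes it below -/
import Mathlib

section
/- Let V be a Hilbert space continuously embedded in C_0^2(Ω,ℝ^d), where Ω is a bounded open subset of ℝ^d, and suppose e^{H(·)} is a bounded continuous probability density on Ω. Then for any data points X_1,…,X_n ∈ Ω and λ > 0 there exists v̂ ∈ V^{[0,1]} such that E_λ(v̂) = sup_{v ∈ V^{[0,1]}} E_λ(v), i.e. the penalized maximum likelihood estimate exists. -/
open MeasureTheory Set Filter
open scoped RealInnerProductSpace BigOperators Topology

noncomputable section

abbrev Euc (d : ℕ) := EuclideanSpace ℝ (Fin d)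

/-- The `C^k` sup-norm `‖f‖_{k,∞} = Σ_{j≤k} sup_{|β|=j} sup_Ω |D^β f|` over `Ω`,
expressed via iterated Fréchet derivatives. -/
def CknormOn {d : ℕ} (k : ℕ) (Ω : Set (Euc d)) (f : Euc d → Euc d) : ℝ :=
  ∑ j ∈ Finset.range (k + 1), ⨆ x ∈ Ω, ‖iteratedFDeriv ℝ j f x‖

/-- Membership in `C_0^k(Ω, ℝ^d)`: `C^k` on `Ω`, with all derivatives of order `≤ k`
extending continuously by `0` to the boundary of `Ω`. -/
def MemC0k {d : ℕ} (k : ℕ) (Ω : Set (Euc d)) (f : Euc d → Euc d) : Prop :=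
  ContDiffOn ℝ k f Ω ∧
    ∀ j ≤ k, ∀ x ∈ frontier Ω,
      Tendsto (iteratedFDeriv ℝ j f) (𝓝[Ω] x) (𝓝 0)

/-- `v ∈ V^{[0,1]}`: a measurable map `[0,1] → V` with `∫₀¹ ‖v_t‖² dt < ∞`. -/
def InV01 {V : Type*} [NormedAddCommGroup V] [MeasurableSpace V] (v : ℝ → V) : Prop :=
  Measurable v ∧ IntegrableOn (fun t => ‖v t‖ ^ 2) (Icc (0:ℝ) 1)

/-- The norm `‖v‖_{V^{[0,1]}} = (∫₀¹ ‖v_t‖² dt)^{1/2}`. -/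
def normV01 {V : Type*} [NormedAddCommGroup V] (v : ℝ → V) : ℝ :=
  Real.sqrt (∫ t in (0:ℝ)..1, ‖v t‖ ^ 2)

/-- Divergence of a vector field: the trace of its Jacobian. -/
def divg {d : ℕ} (f : Euc d → Euc d) (x : Euc d) : ℝ :=
  LinearMap.trace ℝ (Euc d) (fderiv ℝ f x : Euc d →ₗ[ℝ] Euc d)

/-- The penalized log-likelihood
`E_λ(v) = (1/n) Σ_k [log det Dφ^v_1(X_k) + H(φ^v_1(X_k))] − (λ/2)∫₀¹‖v_t‖²dt`,
where `Φ v s t` is the flow of `v` from time `s` to time `t` (so `φ^v_1 = Φ v 0 1`). -/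
def Elam {d : ℕ} {V : Type*} [NormedAddCommGroup V] [InnerProductSpace ℝ V]
    (ι : V →ₗ[ℝ] (Euc d → Euc d)) (Φ : (ℝ → V) → ℝ → ℝ → Euc d → Euc d)
    (H : Euc d → ℝ) {n : ℕ} (X : Fin n → Euc d) (lam : ℝ) (v : ℝ → V) : ℝ :=
  (1 / (n : ℝ)) *
      ∑ k, (Real.log ((fderiv ℝ (Φ v 0 1) (X k)).det) + H (Φ v 0 1 (X k)))
    - (lam / 2) * ∫ t in (0:ℝ)..1, ‖v t‖ ^ 2

set_option linter.unusedSectionVars false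

lemma exp_int_ineq {a : ℝ → ℝ} {T : ℝ} (hT : 0 ≤ T) (ha0 : ∀ t, 0 ≤ a t)
    (ha : IntervalIntegrable a volume 0 T) :
    ∫ u in (0:ℝ)..T, a u * Real.exp (∫ r in (0:ℝ)..u, a r) ≤
      Real.exp (∫ r in (0:ℝ)..T, a r) - 1 := by
  set α : ℝ → ℝ := fun u => ∫ r in (0:ℝ)..u, a r with hα
  have hsub : ∀ s ∈ Icc 0 T, ∀ t ∈ Icc 0 T, IntervalIntegrable a volume s t := by
    intro s hs t ht
    apply ha.mono_set
    rw [uIcc_of_le hT]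
    exact uIcc_subset_Icc hs ht
  have hmono : MonotoneOn (fun u => Real.exp (α u)) (uIcc 0 T) := by
    rw [uIcc_of_le hT]
    intro s hs t ht hst
    apply Real.exp_le_exp.2
    have h1 : α t - α s = ∫ r in s..t, a r :=
      intervalIntegral.integral_interval_sub_left (hsub 0 ⟨le_rfl, hT⟩ t ht)
        (hsub 0 ⟨le_rfl, hT⟩ s hs)
    have h2 : 0 ≤ ∫ r in s..t, a r := intervalIntegral.integral_nonneg hst (fun u _ => ha0 u)
    linarith
  have h1 := hmono.intervalIntegral_deriv_mem_uIcc
  have h2 : ∫ u in (0:ℝ)..T, deriv (fun u => Real.exp (α u)) u =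
      ∫ u in (0:ℝ)..T, a u * Real.exp (α u) := by
    apply intervalIntegral.integral_congr_ae
    filter_upwards [ha.ae_hasDerivAt_integral] with x hx hxT
    have := (hx (uIoc_subset_uIcc hxT) 0 left_mem_uIcc).exp
    rw [this.deriv, mul_comm]
  have h0 : α 0 = 0 := by simp [hα]
  have h3 : 0 ≤ Real.exp (α T) - Real.exp (α 0) := by
    have := hmono left_mem_uIcc right_mem_uIcc hT
    simp only at this
    linarith
  rw [h2, uIcc_of_le h3] at h1
  have := h1.2
  rw [h0] at this
  simpa using this

lemma gron {a y : ℝ → ℝ} {A T : ℝ} (hA : 0 ≤ A) (hT : 0 ≤ T) (ha0 : ∀ t, 0 ≤ a t)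
    (ha : IntervalIntegrable a volume 0 T) (hy : ContinuousOn y (Icc 0 T))
    (h : ∀ t ∈ Icc 0 T, y t ≤ A + ∫ u in (0:ℝ)..t, a u * y u) :
    ∀ t ∈ Icc 0 T, y t ≤ A * Real.exp (∫ u in (0:ℝ)..t, a u) := by
  set α : ℝ → ℝ := fun u => ∫ r in (0:ℝ)..u, a r with hα
  have hαc : ContinuousOn α (Icc 0 T) := by
    have := intervalIntegral.continuousOn_primitive_interval' ha (left_mem_uIcc)
    rwa [uIcc_of_le hT] at this
  have key : ∀ δ > 0, ∀ t ∈ Icc 0 T, y t < (A + δ) * Real.exp (α t) := by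
    intro δ hδ
    by_contra! hcon
    set S := {t ∈ Icc 0 T | (A + δ) * Real.exp (α t) ≤ y t} with hS
    have hSc : IsCompact S := by
      apply isCompact_Icc.of_isClosed_subset _ (fun t ht => ht.1)
      exact isClosed_Icc.isClosed_le (continuousOn_const.mul hαc.rexp) hy
    obtain ⟨t0, ht0, hmin⟩ := hSc.exists_isLeast (by obtain ⟨t, ht, h'⟩ := hcon; exact ⟨t, ht, h'⟩)
    have hsub : Icc 0 t0 ⊆ Icc 0 T := Icc_subset_Icc_right ht0.1.2
    have hlt : ∀ u ∈ Ico 0 t0, y u ≤ (A + δ) * Real.exp (α u) := by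
      intro u hu
      by_contra! hc
      exact absurd (hmin ⟨hsub ⟨hu.1, hu.2.le⟩, hc.le⟩) (not_le.2 hu.2)
    have hle : ∀ u ∈ Icc 0 t0, u ≠ t0 → a u * y u ≤ (A + δ) * (a u * Real.exp (α u)) := by
      intro u hu hne
      have := mul_le_mul_of_nonneg_left (hlt u ⟨hu.1, lt_of_le_of_ne hu.2 hne⟩) (ha0 u)
      linarith
    have hat : IntervalIntegrable a volume 0 t0 := by
      apply ha.mono_set
      rw [uIcc_of_le hT, uIcc_of_le ht0.1.1]; exact hsub
    have i1 : IntervalIntegrable (fun u => a u * y u) volume 0 t0 :=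
      hat.mul_continuousOn (by rw [uIcc_of_le ht0.1.1]; exact hy.mono hsub)
    have i2 : IntervalIntegrable (fun u => a u * Real.exp (α u)) volume 0 t0 :=
      hat.mul_continuousOn (by rw [uIcc_of_le ht0.1.1]; exact (hαc.mono hsub).rexp)
    have e1 : ∫ u in (0:ℝ)..t0, a u * y u ≤ ∫ u in (0:ℝ)..t0, (A + δ) * (a u * Real.exp (α u)) := by
      apply intervalIntegral.integral_mono_ae_restrict ht0.1.1 i1 (i2.const_mul _)
      have : ∀ᵐ u : ℝ, u ≠ t0 := by simp [ae_iff, measure_singleton]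
      filter_upwards [ae_restrict_of_ae this, ae_restrict_mem measurableSet_Icc] with u h1 h2
      exact hle u h2 h1
    rw [intervalIntegral.integral_const_mul] at e1
    have e2 := exp_int_ineq ht0.1.1 ha0 hat
    have e3 := h t0 ht0.1
    have e4 := ht0.2
    have e5 : (A + δ) * ∫ u in (0:ℝ)..t0, a u * Real.exp (α u) ≤ (A + δ) * (Real.exp (α t0) - 1) :=
      mul_le_mul_of_nonneg_left e2 (by linarith)
    linarith
  intro t ht
  apply le_of_forall_pos_le_add
  intro ε hε
  have hp := Real.exp_pos (α t)
  have := key (ε / Real.exp (α t)) (by positivity) t ht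
  rw [add_mul, div_mul_cancel₀ _ hp.ne'] at this
  exact this.le

lemma gron_back {a y : ℝ → ℝ} {A T : ℝ} (hA : 0 ≤ A) (hT : 0 ≤ T) (ha0 : ∀ t, 0 ≤ a t)
    (ha : IntervalIntegrable a volume 0 T) (hy : ContinuousOn y (Icc 0 T))
    (h : ∀ t ∈ Icc 0 T, y t ≤ A + ∫ u in t..T, a u * y u) :
    y 0 ≤ A * Real.exp (∫ u in (0:ℝ)..T, a u) := by
  have hmem : ∀ t ∈ Icc 0 T, T - t ∈ Icc 0 T := fun t ht => ⟨by linarith [ht.2], by linarith [ht.1]⟩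
  have := gron (a := fun t => a (T - t)) (y := fun t => y (T - t)) hA hT (fun t => ha0 _)
    (by simpa using (ha.comp_sub_left T).symm)
    (hy.comp (by fun_prop) (fun t ht => hmem t ht)) (by
      intro t ht
      have h1 := h _ (hmem t ht)
      have h2 := intervalIntegral.integral_comp_sub_left (a := 0) (b := t) (fun u => a u * y u) T
      rw [h2]; simpa using h1) T ⟨hT, le_rfl⟩
  have h2 := intervalIntegral.integral_comp_sub_left (a := 0) (b := T) (fun u => a u) T
  rw [h2] at this
  simpa using this

lemma lip_aux {E F : Type*} [NormedAddCommGroup E] [NormedSpace ℝ E] [NormedAddCommGroup F]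
    [NormedSpace ℝ F] {Ω B : Set E} (hΩ : IsOpen Ω) (hB : Convex ℝ B) {g : E → F}
    {g' : E → E →L[ℝ] F} {C : ℝ} (hgc : Continuous g)
    (hg0 : ∀ z, z ∉ Ω → g z = 0) (hg' : ∀ z ∈ Ω, HasFDerivAt g (g' z) z)
    (hC : ∀ z ∈ Ω, z ∈ B → ‖g' z‖ ≤ C) {x y : E} (hx : x ∈ B) (hy : y ∈ B) (hyΩ : y ∉ Ω) :
    ‖g x‖ ≤ C * ‖y - x‖ ∨ x ∉ Ω := by
  by_cases hxΩ : x ∈ Ω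
  swap
  · exact Or.inr hxΩ
  left
  set γ : ℝ → E := fun t => x + t • (y - x) with hγ
  have hγc : Continuous γ := by fun_prop
  set S := {t ∈ Icc (0:ℝ) 1 | γ t ∉ Ω} with hS
  have hSc : IsCompact S := by
    apply isCompact_Icc.of_isClosed_subset _ (fun t ht => ht.1)
    exact isClosed_Icc.inter (hΩ.isClosed_compl.preimage hγc)
  obtain ⟨t0, ht0, hmin⟩ := hSc.exists_isLeast ⟨1, by simp, by simpa [hγ] using hyΩ⟩
  have hin : ∀ t ∈ Ico 0 t0, γ t ∈ Ω := by
    intro t ht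
    by_contra hc
    exact absurd (hmin ⟨⟨ht.1, ht.2.le.trans ht0.1.2⟩, hc⟩) (not_le.2 ht.2)
  have hγB : ∀ t ∈ Icc (0:ℝ) 1, γ t ∈ B := fun t ht => hB.add_smul_sub_mem hx hy ht
  have h1 := norm_image_sub_le_of_norm_deriv_right_le_segment (a := 0) (b := t0)
    (f := fun t => g (γ t)) (f' := fun t => g' (γ t) (y - x)) (C := C * ‖y - x‖)
    (hgc.comp hγc).continuousOn (by
      intro t ht
      have hd : HasDerivAt γ (y - x) t := by
        have := ((hasDerivAt_id t).smul_const (y - x)).const_add x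
        rw [one_smul] at this
        exact this
      exact ((hg' _ (hin t ht)).comp_hasDerivAt t hd).hasDerivWithinAt) (by
      intro t ht
      exact (ContinuousLinearMap.le_opNorm _ _).trans
        (mul_le_mul_of_nonneg_right (hC _ (hin t ht) (hγB t ⟨ht.1, ht.2.le.trans ht0.1.2⟩))
          (norm_nonneg _))) t0 ⟨ht0.1.1, le_rfl⟩
  simp only [hg0 _ ht0.2, zero_sub, norm_neg] at h1
  have h0 : γ 0 = x := by simp [hγ]
  rw [h0, sub_zero] at h1
  have hC0 : 0 ≤ C := (norm_nonneg _).trans (hC x hxΩ hx)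
  calc _ ≤ _ := h1
    _ ≤ _ := mul_le_of_le_one_right (by positivity) ht0.1.2

lemma lip_ext {E F : Type*} [NormedAddCommGroup E] [NormedSpace ℝ E] [NormedAddCommGroup F]
    [NormedSpace ℝ F] {Ω B : Set E} (hΩ : IsOpen Ω) (hB : Convex ℝ B) {g : E → F}
    {g' : E → E →L[ℝ] F} {C : ℝ} (hC0 : 0 ≤ C) (hgc : Continuous g)
    (hg0 : ∀ z, z ∉ Ω → g z = 0) (hg' : ∀ z ∈ Ω, HasFDerivAt g (g' z) z)
    (hC : ∀ z ∈ Ω, z ∈ B → ‖g' z‖ ≤ C) {x y : E} (hx : x ∈ B) (hy : y ∈ B) :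
    ‖g y - g x‖ ≤ C * ‖y - x‖ := by
  by_cases hseg : segment ℝ x y ⊆ Ω
  · exact Convex.norm_image_sub_le_of_norm_hasFDerivWithin_le (s := segment ℝ x y) (f' := g')
      (fun z hz => (hg' z (hseg hz)).hasFDerivWithinAt)
      (fun z hz => hC z (hseg hz) (hB.segment_subset hx hy hz)) (convex_segment x y)
      (left_mem_segment _ _ _) (right_mem_segment _ _ _)
  · obtain ⟨z, hz, hzΩ⟩ := not_subset.1 hseg
    have hzB := hB.segment_subset hx hy hz
    have key : ∀ p ∈ B, ‖g p‖ ≤ C * ‖z - p‖ := by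
      intro p hp
      rcases lip_aux hΩ hB hgc hg0 hg' hC hp hzB hzΩ with h | h
      · exact h
      · rw [hg0 p h, norm_zero]; positivity
    have h1 : ‖z - x‖ + ‖z - y‖ = ‖y - x‖ := by
      have := dist_add_dist_of_mem_segment hz
      rw [dist_eq_norm', dist_eq_norm', dist_eq_norm' x y] at this
      rw [norm_sub_rev z y]; exact this
    calc ‖g y - g x‖ ≤ ‖g y‖ + ‖g x‖ := norm_sub_le _ _
      _ ≤ C * ‖z - y‖ + C * ‖z - x‖ := add_le_add (key y hy) (key x hx)
      _ = _ := by rw [← h1]; ring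

/-- continuity of the extension by zero -/
lemma cont_ext {E F : Type*} [NormedAddCommGroup E] [NormedAddCommGroup F]
    {Ω : Set E} (hΩ : IsOpen Ω) {g : E → F} (hc : ContinuousOn g Ω)
    (h0 : ∀ x ∈ frontier Ω, Tendsto g (𝓝[Ω] x) (𝓝 0)) : Continuous (Ω.indicator g) := by
  rw [continuous_iff_continuousAt]
  intro x
  by_cases hx : x ∈ Ω
  · have : Ω.indicator g =ᶠ[𝓝 x] g := by
      filter_upwards [hΩ.mem_nhds hx] with y hy
      exact indicator_of_mem hy g
    exact ((hc.continuousAt (hΩ.mem_nhds hx)).congr this.symm)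
  · rw [ContinuousAt, indicator_of_notMem hx]
    have h1 : Tendsto (Ω.indicator g) (𝓝[Ωᶜ] x) (𝓝 0) := by
      apply tendsto_const_nhds.congr'
      filter_upwards [self_mem_nhdsWithin] with y hy
      exact (indicator_of_notMem hy g).symm
    have h2 : Tendsto (Ω.indicator g) (𝓝[Ω] x) (𝓝 0) := by
      by_cases hxf : x ∈ frontier Ω
      · apply (h0 x hxf).congr'
        filter_upwards [self_mem_nhdsWithin] with y hy
        exact (indicator_of_mem hy g).symm
      · have : x ∉ closure Ω := fun h => hxf (by rw [hΩ.frontier_eq]; exact ⟨h, hx⟩)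
        rw [mem_closure_iff_nhdsWithin_neBot, not_neBot] at this
        rw [this]; exact tendsto_bot
    have := h2.sup h1
    rwa [← nhdsWithin_union, union_compl_self, nhdsWithin_univ] at this

lemma bdd_ext {E F : Type*} [NormedAddCommGroup E] [NormedAddCommGroup F] [ProperSpace E]
    {Ω : Set E} (hΩ : IsOpen Ω) (hb : Bornology.IsBounded Ω) {g : E → F} (hc : ContinuousOn g Ω)
    (h0 : ∀ x ∈ frontier Ω, Tendsto g (𝓝[Ω] x) (𝓝 0)) {M : ℝ} (hM : ⨆ x ∈ Ω, ‖g x‖ ≤ M) :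
    ∀ x ∈ Ω, ‖g x‖ ≤ M := by
  intro x hx
  have hcont := cont_ext hΩ hc h0
  have hK : IsCompact (closure Ω) := hb.isCompact_closure
  obtain ⟨C, hC⟩ := (hK.image hcont.norm).bddAbove
  have hC' : ∀ y ∈ Ω, ‖g y‖ ≤ C := by
    intro y hy
    have := hC ⟨y, subset_closure hy, rfl⟩
    simpa [indicator_of_mem hy] using this
  have hbdd : BddAbove (range fun x => ⨆ (_ : x ∈ Ω), ‖g x‖) := by
    refine ⟨max C 0, ?_⟩
    rintro _ ⟨y, rfl⟩
    by_cases hy : y ∈ Ω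
    · simp [hy, hC' y hy]
    · simp [hy]
  have := le_ciSup hbdd x
  simp only [hx, ciSup_unique] at this
  exact this.trans hM

lemma ext_main {E F : Type*} [NormedAddCommGroup E] [NormedSpace ℝ E] [NormedAddCommGroup F]
    [NormedSpace ℝ F] [ProperSpace E]
    {Ω : Set E} (hΩ : IsOpen Ω) (hb : Bornology.IsBounded Ω) {g : E → F}
    (hc : ContDiffOn ℝ 2 g Ω)
    (h0 : ∀ j ≤ 2, ∀ x ∈ frontier Ω, Tendsto (iteratedFDeriv ℝ j g) (𝓝[Ω] x) (𝓝 0))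
    {M : ℝ} (hM0 : 0 ≤ M) (hM : ∀ j ≤ 2, ⨆ x ∈ Ω, ‖iteratedFDeriv ℝ j g x‖ ≤ M) :
    (∀ x, ‖Ω.indicator g x‖ ≤ M) ∧ (∀ x y, ‖Ω.indicator g y - Ω.indicator g x‖ ≤ M * ‖y - x‖) ∧
    ∃ D : E → E →L[ℝ] F, (∀ x, ‖D x‖ ≤ M) ∧
      ∀ x y, ‖Ω.indicator g y - Ω.indicator g x - D x (y - x)‖ ≤ M * ‖y - x‖ ^ 2 := by
  have hcont : ∀ j ≤ 2, ContinuousOn (iteratedFDeriv ℝ j g) Ω := by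
    intro j hj
    have := hc.continuousOn_iteratedFDerivWithin (m := j) (by exact_mod_cast hj) hΩ.uniqueDiffOn
    exact this.congr (fun x hx => (iteratedFDerivWithin_of_isOpen j hΩ hx).symm)
  have hbd : ∀ j ≤ 2, ∀ x ∈ Ω, ‖iteratedFDeriv ℝ j g x‖ ≤ M := fun j hj =>
    bdd_ext hΩ hb (hcont j hj) (h0 j hj) (hM j hj)
  have hd : ∀ x ∈ Ω, HasFDerivAt g (fderiv ℝ g x) x := fun x hx =>
    ((hc.contDiffAt (hΩ.mem_nhds hx)).differentiableAt (by norm_num)).hasFDerivAt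
  have hcd : ContDiffOn ℝ 1 (fderiv ℝ g) Ω := hc.fderiv_of_isOpen hΩ (by norm_num)
  have hdd : ∀ x ∈ Ω, HasFDerivAt (fderiv ℝ g) (fderiv ℝ (fderiv ℝ g) x) x := fun x hx =>
    ((hcd.contDiffAt (hΩ.mem_nhds hx)).differentiableAt (by norm_num)).hasFDerivAt
  have b0 : ∀ x ∈ Ω, ‖g x‖ ≤ M := fun x hx => by simpa using hbd 0 (by norm_num) x hx
  have b1 : ∀ x ∈ Ω, ‖fderiv ℝ g x‖ ≤ M := fun x hx => by
    rw [← norm_iteratedFDeriv_one]; exact hbd 1 (by norm_num) x hx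
  have b2 : ∀ x ∈ Ω, ‖fderiv ℝ (fderiv ℝ g) x‖ ≤ M := fun x hx => by
    rw [← norm_iteratedFDeriv_one, norm_iteratedFDeriv_fderiv]; exact hbd 2 (by norm_num) x hx
  have c0 : Continuous (Ω.indicator g) := cont_ext hΩ hc.continuousOn (fun x hx => by
    have := h0 0 (by norm_num) x hx
    rw [tendsto_zero_iff_norm_tendsto_zero] at this ⊢
    simpa using this)
  have c1 : Continuous (Ω.indicator (fderiv ℝ g)) := cont_ext hΩ hcd.continuousOn (fun x hx => by
    have := h0 1 (by norm_num) x hx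
    rw [tendsto_zero_iff_norm_tendsto_zero] at this ⊢
    simpa only [norm_iteratedFDeriv_one] using this)
  have d0 : ∀ x ∈ Ω, HasFDerivAt (Ω.indicator g) (fderiv ℝ g x) x := fun x hx =>
    (hd x hx).congr_of_eventuallyEq (by
      filter_upwards [hΩ.mem_nhds hx] with y hy
      exact indicator_of_mem hy g)
  have d1 : ∀ x ∈ Ω, HasFDerivAt (Ω.indicator (fderiv ℝ g)) (fderiv ℝ (fderiv ℝ g) x) x :=
    fun x hx => (hdd x hx).congr_of_eventuallyEq (by
      filter_upwards [hΩ.mem_nhds hx] with y hy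
      exact indicator_of_mem hy _)
  have z0 : ∀ z, z ∉ Ω → Ω.indicator g z = 0 := fun z hz => indicator_of_notMem hz _
  have z1 : ∀ z, z ∉ Ω → Ω.indicator (fderiv ℝ g) z = 0 := fun z hz => indicator_of_notMem hz _
  have l0 : ∀ x y, ‖Ω.indicator g y - Ω.indicator g x‖ ≤ M * ‖y - x‖ := fun x y =>
    lip_ext hΩ convex_univ hM0 c0 z0 d0 (fun z hz _ => b1 z hz) (mem_univ x) (mem_univ y)
  have l1 : ∀ x y, ‖Ω.indicator (fderiv ℝ g) y - Ω.indicator (fderiv ℝ g) x‖ ≤ M * ‖y - x‖ :=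
    fun x y =>
    lip_ext hΩ convex_univ hM0 c1 z1 d1 (fun z hz _ => b2 z hz) (mem_univ x) (mem_univ y)
  have hD : ∀ x, HasFDerivAt (Ω.indicator g) (Ω.indicator (fderiv ℝ g) x) x := by
    intro x
    by_cases hx : x ∈ Ω
    · rw [indicator_of_mem hx]; exact d0 x hx
    · rw [z1 x hx]
      apply HasFDerivAt.of_isLittleO
      have hO : (fun y => Ω.indicator g y - Ω.indicator g x - (0 : E →L[ℝ] F) (y - x)) =O[𝓝 x]
          fun y => ‖y - x‖ ^ 2 := by
        apply Asymptotics.IsBigO.of_bound M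
        filter_upwards with y
        simp only [zero_apply, sub_zero, norm_pow, norm_norm]
        have := lip_ext (B := Metric.closedBall x ‖y - x‖) (C := M * ‖y - x‖) hΩ
          (convex_closedBall _ _) (by positivity) c0 z0 d0 (x := x) (y := y) (fun z hz hzB => by
            have h1 := l1 x z
            rw [z1 x hx, sub_zero, indicator_of_mem hz] at h1
            rw [mem_closedBall_iff_norm] at hzB
            exact h1.trans (mul_le_mul_of_nonneg_left hzB hM0))
          (by simp) (by rw [mem_closedBall_iff_norm])
        calc _ ≤ _ := this
          _ = _ := by ring
      exact hO.trans_isLittleO (Asymptotics.isLittleO_pow_sub_sub x (by norm_num))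
  refine ⟨?_, l0, Ω.indicator (fderiv ℝ g), ?_, ?_⟩
  · intro x
    by_cases hx : x ∈ Ω
    · rw [indicator_of_mem hx]; exact b0 x hx
    · rw [z0 x hx, norm_zero]; exact hM0
  · intro x
    by_cases hx : x ∈ Ω
    · rw [indicator_of_mem hx]; exact b1 x hx
    · rw [z1 x hx, norm_zero]; exact hM0
  · intro x y
    have := Convex.norm_image_sub_le_of_norm_hasFDerivWithin_le' (s := Metric.closedBall x ‖y - x‖)
      (f' := Ω.indicator (fderiv ℝ g)) (φ := Ω.indicator (fderiv ℝ g) x) (C := M * ‖y - x‖)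
      (x := x) (y := y)
      (fun z _ => (hD z).hasFDerivWithinAt) (fun z hz => by
        rw [mem_closedBall_iff_norm] at hz
        exact (l1 x z).trans (mul_le_mul_of_nonneg_left hz hM0)) (convex_closedBall _ _)
        (by simp) (by rw [mem_closedBall_iff_norm])
    calc _ ≤ _ := this
      _ = _ := by ring

structure GoodG {d : ℕ} {V : Type*} [NormedAddCommGroup V] [InnerProductSpace ℝ V]
    (Ω : Set (Euc d)) (c : ℝ) (G : V → Euc d → Euc d) : Prop where
  c0 : 0 ≤ c
  op : IsOpen Ω
  add : ∀ f g y, G (f + g) y = G f y + G g y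
  smul : ∀ (r : ℝ) f y, G (r • f) y = r • G f y
  off : ∀ f y, y ∉ Ω → G f y = 0
  b0 : ∀ f y, ‖G f y‖ ≤ c * ‖f‖
  lip : ∀ f y z, ‖G f z - G f y‖ ≤ c * ‖f‖ * ‖z - y‖
  tay : ∀ f y, ∃ D : Euc d →L[ℝ] Euc d, ‖D‖ ≤ c * ‖f‖ ∧
    ∀ z, ‖G f z - G f y - D (z - y)‖ ≤ c * ‖f‖ * ‖z - y‖ ^ 2

structure IsPath {d : ℕ} {V : Type*} (Ω : Set (Euc d)) (G : V → Euc d → Euc d) (v : ℝ → V)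
    (x : Euc d) (ψ : ℝ → Euc d) : Prop where
  cont : ContinuousOn ψ (Icc 0 1)
  mem : ∀ t ∈ Icc (0:ℝ) 1, ψ t ∈ Ω
  int : IntervalIntegrable (fun u => G (v u) (ψ u)) volume 0 1
  eq : ∀ t ∈ Icc (0:ℝ) 1, ψ t = x + ∫ u in (0:ℝ)..t, G (v u) (ψ u)

section
variable {d : ℕ} {V : Type*} [NormedAddCommGroup V] [InnerProductSpace ℝ V]
  {Ω : Set (Euc d)} {c : ℝ} {G : V → Euc d → Euc d}

lemma GoodG.cont (hG : GoodG Ω c G) : Continuous (fun p : V × Euc d => G p.1 p.2) := by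
  rw [continuous_iff_continuousAt]
  rintro ⟨f0, y0⟩
  rw [ContinuousAt, tendsto_iff_norm_sub_tendsto_zero]
  apply squeeze_zero (g := fun p : V × Euc d => c * ‖p.1 - f0‖ + c * ‖f0‖ * ‖p.2 - y0‖)
  · intro p; exact norm_nonneg _
  · rintro ⟨f, y⟩
    have h1 : G f y = G (f - f0) y + G f0 y := by rw [← hG.add]; simp
    have h2 : G f y - G f0 y0 = G (f - f0) y + (G f0 y - G f0 y0) := by rw [h1]; abel
    simp only
    rw [h2]
    exact (norm_add_le _ _).trans (add_le_add (hG.b0 _ _) (hG.lip _ _ _))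
  · have : Continuous (fun p : V × Euc d => c * ‖p.1 - f0‖ + c * ‖f0‖ * ‖p.2 - y0‖) := by fun_prop
    have := this.tendsto (f0, y0)
    simpa using this

lemma int1 [MeasurableSpace V] [BorelSpace V] {v : ℝ → V} (hv : InV01 v) {s t : ℝ}
    (hs : s ∈ Icc (0:ℝ) 1) (ht : t ∈ Icc (0:ℝ) 1) :
    IntervalIntegrable (fun u => ‖v u‖) volume s t ∧
    IntervalIntegrable (fun u => ‖v u‖ ^ 2) volume s t := by
  have h2 : IntegrableOn (fun u => ‖v u‖) (Icc (0:ℝ) 1) := by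
    have h3 : IntegrableOn (fun u => 1 + ‖v u‖ ^ 2) (Icc (0:ℝ) 1) :=
      (integrableOn_const (by simp)).add hv.2
    apply Integrable.mono' h3 hv.1.norm.aestronglyMeasurable
    filter_upwards with u
    rw [norm_norm]; nlinarith [sq_nonneg (‖v u‖ - 1)]
  have hsub : uIcc s t ⊆ Icc 0 1 := uIcc_subset_Icc hs ht
  exact ⟨(h2.mono_set hsub).intervalIntegrable, (hv.2.mono_set hsub).intervalIntegrable⟩

lemma int1_bound [MeasurableSpace V] [BorelSpace V] {v : ℝ → V} (hv : InV01 v) {s t η : ℝ}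
    (hs : 0 ≤ s) (hst : s ≤ t) (ht : t ≤ 1) (hη : 0 < η) :
    ∫ u in s..t, ‖v u‖ ≤ η * (∫ u in (0:ℝ)..1, ‖v u‖ ^ 2) + (t - s) / η := by
  have i := int1 hv (s := s) (t := t) ⟨hs, hst.trans ht⟩ ⟨hs.trans hst, ht⟩
  have e1 : ∫ u in s..t, ‖v u‖ ≤ ∫ u in s..t, (η * ‖v u‖ ^ 2 + 1 / η) := by
    apply intervalIntegral.integral_mono_on hst i.1 ((i.2.const_mul _).add intervalIntegrable_const)
    intro u _
    have h : 0 ≤ (η * ‖v u‖ - 1) ^ 2 / η := by positivity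
    have h2 : (η * ‖v u‖ - 1) ^ 2 / η = η * ‖v u‖ ^ 2 + 1 / η - 2 * ‖v u‖ := by
      field_simp; ring
    have := norm_nonneg (v u)
    linarith
  rw [intervalIntegral.integral_add (i.2.const_mul _) intervalIntegrable_const,
    intervalIntegral.integral_const_mul, intervalIntegral.integral_const] at e1
  have e2 : ∫ u in s..t, ‖v u‖ ^ 2 ≤ ∫ u in (0:ℝ)..1, ‖v u‖ ^ 2 := by
    apply intervalIntegral.integral_mono_interval hs hst ht
    · filter_upwards with u; positivity
    · exact (int1 hv (by simp) (by simp)).2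
  have e3 := mul_le_mul_of_nonneg_left e2 hη.le
  have e4 : (t - s) • (1 / η) = (t - s) / η := by simp [div_eq_mul_inv]
  linarith

lemma path_stay [MeasurableSpace V] [BorelSpace V] (hG : GoodG Ω c G) {v : ℝ → V} (hv : InV01 v)
    {x : Euc d} (hx : x ∈ Ω) {k : ℝ → Euc d → Euc d} (hk : ∀ u, ∀ y ∈ Ω, k u y = G (v u) y)
    {ψ : ℝ → Euc d}
    (hψ : ∀ t ∈ Icc (0:ℝ) 1, ψ t = x + ∫ u in (0:ℝ)..t, k u (ψ u))
    {T : ℝ} (hT : T ∈ Icc (0:ℝ) 1) (hi : IntervalIntegrable (fun u => k u (ψ u)) volume 0 T) :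
    ContinuousOn ψ (Icc 0 T) ∧ ∀ t ∈ Icc 0 T, ψ t ∈ Ω := by
  have hsub : Icc 0 T ⊆ Icc 0 1 := Icc_subset_Icc_right hT.2
  have hc : ContinuousOn ψ (Icc 0 T) := by
    have := intervalIntegral.continuousOn_primitive_interval' hi left_mem_uIcc
    rw [uIcc_of_le hT.1] at this
    exact (continuousOn_const.add this).congr (fun t ht => hψ t (hsub ht))
  refine ⟨hc, ?_⟩
  by_contra! hcon
  set S := {t ∈ Icc 0 T | ψ t ∉ Ω} with hS
  have hSc : IsCompact S := by
    apply isCompact_Icc.of_isClosed_subset _ (fun t ht => ht.1)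
    exact hc.preimage_isClosed_of_isClosed isClosed_Icc hG.op.isClosed_compl
  obtain ⟨t0, ht0, hmin⟩ := hSc.exists_isLeast (by obtain ⟨t, ht, h'⟩ := hcon; exact ⟨t, ht, h'⟩)
  have hin : ∀ t ∈ Ico 0 t0, ψ t ∈ Ω := by
    intro t ht
    by_contra hc
    exact absurd (hmin ⟨⟨ht.1, ht.2.le.trans ht0.1.2⟩, hc⟩) (not_le.2 ht.2)
  have hsub0 : Icc 0 t0 ⊆ Icc 0 T := Icc_subset_Icc_right ht0.1.2
  have hii : ∀ s ∈ Icc 0 t0, IntervalIntegrable (fun u => k u (ψ u)) volume 0 s := by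
    intro s hs
    apply hi.mono_set
    rw [uIcc_of_le hT.1, uIcc_of_le hs.1]; exact Icc_subset_Icc_right (hs.2.trans ht0.1.2)
  have ht01 : t0 ∈ Icc (0:ℝ) 1 := hsub ht0.1
  have hia : IntervalIntegrable (fun u => c * ‖v u‖) volume 0 t0 :=
    (int1 hv (by simp) ht01).1.const_mul c
  have hyc : ContinuousOn (fun u => ‖ψ u - ψ t0‖) (Icc 0 t0) :=
    ((hc.mono hsub0).sub continuousOn_const).norm
  have := gron_back (a := fun u => c * ‖v u‖) (y := fun u => ‖ψ u - ψ t0‖) (A := 0) (T := t0)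
    le_rfl ht0.1.1 (fun t => mul_nonneg hG.c0 (norm_nonneg _)) hia hyc (by
      intro t ht
      have h1 : ψ t0 - ψ t = ∫ u in t..t0, k u (ψ u) := by
        rw [hψ t0 ht01, hψ t (hsub (hsub0 ht)), add_sub_add_left_eq_sub]
        exact intervalIntegral.integral_interval_sub_left (hii t0 ⟨ht0.1.1, le_rfl⟩) (hii t ht)
      simp only [zero_add]
      rw [norm_sub_rev, h1]
      apply intervalIntegral.norm_integral_le_of_norm_le ht.2
      · have : ∀ᵐ u : ℝ, u ≠ t0 := by simp [ae_iff, measure_singleton]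
        filter_upwards [this] with u hu1 hu2
        have hu : ψ u ∈ Ω := hin u ⟨ht.1.trans hu2.1.le, lt_of_le_of_ne hu2.2 hu1⟩
        rw [hk u _ hu]
        have := hG.lip (v u) (ψ t0) (ψ u)
        rwa [hG.off (v u) (ψ t0) ht0.2, sub_zero] at this
      · refine (hia.mul_continuousOn (by rw [uIcc_of_le ht0.1.1]; exact hyc)).mono_set ?_
        rw [uIcc_of_le ht0.1.1, uIcc_of_le ht.2]; exact Icc_subset_Icc_left ht.1)
  simp only [zero_mul] at this
  have h0 : ψ 0 = ψ t0 := by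
    rw [← sub_eq_zero, ← norm_le_zero_iff]; exact this
  have h00 : ψ 0 = x := by rw [hψ 0 (by simp)]; simp
  exact ht0.2 (by rw [← h0, h00]; exact hx)

lemma path_of_flow [MeasurableSpace V] [BorelSpace V] [SecondCountableTopology V]
    (hG : GoodG Ω c G) {v : ℝ → V} (hv : InV01 v)
    {x : Euc d} (hx : x ∈ Ω) {k : ℝ → Euc d → Euc d} (hk : ∀ u, ∀ y ∈ Ω, k u y = G (v u) y)
    {ψ : ℝ → Euc d}
    (hψ : ∀ t ∈ Icc (0:ℝ) 1, ψ t = x + ∫ u in (0:ℝ)..t, k u (ψ u)) :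
    IsPath Ω G v x ψ := by
  set g : ℝ → Euc d := fun u => k u (ψ u) with hg
  set S := {t ∈ Icc (0:ℝ) 1 | IntervalIntegrable g volume 0 t} with hS
  have hS0 : (0:ℝ) ∈ S := ⟨by simp, IntervalIntegrable.refl⟩
  have hSb : BddAbove S := ⟨1, fun t ht => ht.1.2⟩
  set τ := sSup S with hτ
  have hτ0 : 0 ≤ τ := le_csSup hSb hS0
  have hτ1 : τ ≤ 1 := csSup_le ⟨0, hS0⟩ (fun t ht => ht.1.2)
  have hlt : ∀ u, u < τ → ∃ s ∈ S, u < s := fun u hu => exists_lt_of_lt_csSup ⟨0, hS0⟩ hu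
  have hstay := fun s (hs : s ∈ S) => path_stay hG hv hx hk hψ hs.1 hs.2
  have hc1 : ContinuousOn ψ (Ico 0 τ) := by
    intro u hu
    obtain ⟨s, hs, hus⟩ := hlt u hu.2
    apply ((hstay s hs).1 u ⟨hu.1, hus.le⟩).mono_of_mem_nhdsWithin
    filter_upwards [self_mem_nhdsWithin, mem_nhdsWithin_of_mem_nhds (Iio_mem_nhds hus)] with y h1 h2
    exact ⟨h1.1, le_of_lt h2⟩
  have hm1 : ∀ u ∈ Ico 0 τ, ψ u ∈ Ω := by
    intro u hu
    obtain ⟨s, hs, hus⟩ := hlt u hu.2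
    exact (hstay s hs).2 u ⟨hu.1, hus.le⟩
  have hx2 : ∀ u ∈ Ioc τ 1, ψ u = x := by
    intro u hu
    have hu1 : u ∈ Icc (0:ℝ) 1 := ⟨hτ0.trans hu.1.le, hu.2⟩
    have : ¬ IntervalIntegrable g volume 0 u := fun h =>
      absurd (le_csSup hSb (show u ∈ S from ⟨hu1, h⟩)) (not_le.2 hu.1)
    rw [hψ u hu1, intervalIntegral.integral_undef this, add_zero]
  have hnorm := (int1 hv (s := 0) (t := 1) (by simp) (by simp)).1
  rw [intervalIntegrable_iff_integrableOn_Icc_of_le zero_le_one] at hnorm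
  have hvm : AEStronglyMeasurable v volume := hv.1.aestronglyMeasurable
  have gen : ∀ A : Set ℝ, MeasurableSet A → A ⊆ Icc 0 1 → ContinuousOn ψ A → (∀ u ∈ A, ψ u ∈ Ω) →
      IntegrableOn g A := by
    intro A hA hA1 hAc hAm
    have hmeas : AEStronglyMeasurable (fun u => G (v u) (ψ u)) (volume.restrict A) :=
      hG.cont.comp_aestronglyMeasurable (hvm.restrict.prodMk (hAc.aestronglyMeasurable hA))
    have hi : IntegrableOn (fun u => G (v u) (ψ u)) A := by
      apply Integrable.mono' ((hnorm.mono_set hA1).const_mul c) hmeas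
      filter_upwards with u
      exact hG.b0 _ _
    exact hi.congr_fun (fun u hu => (hk u _ (hAm u hu)).symm) hA
  have I1 := gen (Ico 0 τ) measurableSet_Ico (fun u hu => ⟨hu.1, hu.2.le.trans hτ1⟩) hc1 hm1
  have I2 := gen (Ioc τ 1) measurableSet_Ioc (fun u hu => ⟨hτ0.trans hu.1.le, hu.2⟩)
    (continuousOn_const.congr hx2) (fun u hu => by rw [hx2 u hu]; exact hx)
  have I3 : IntegrableOn g {τ} := by simp
  have I : IntegrableOn g (Icc 0 1) := by
    apply ((I1.union I2).union I3).mono_set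
    intro u hu
    rcases lt_trichotomy u τ with h | h | h
    · exact Or.inl (Or.inl ⟨hu.1, h⟩)
    · exact Or.inr h
    · exact Or.inl (Or.inr ⟨h, hu.2⟩)
  have II : IntervalIntegrable g volume 0 1 :=
    (intervalIntegrable_iff_integrableOn_Icc_of_le zero_le_one).2 I
  have hfin := path_stay hG hv hx hk hψ (T := 1) (by simp) II
  refine ⟨hfin.1, hfin.2, ?_, ?_⟩
  · refine (intervalIntegrable_iff_integrableOn_Icc_of_le zero_le_one).2 ?_
    exact I.congr_fun (fun u hu => hk u _ (hfin.2 u hu)) measurableSet_Icc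
  · intro t ht
    rw [hψ t ht]
    congr 1
    apply intervalIntegral.integral_congr
    intro u hu
    rw [uIcc_of_le ht.1] at hu
    exact hk u _ (hfin.2 u ⟨hu.1, hu.2.trans ht.2⟩)

lemma IsPath.int' {v : ℝ → V} {x : Euc d} {ψ : ℝ → Euc d} (h : IsPath Ω G v x ψ) {s t : ℝ}
    (hs : s ∈ Icc (0:ℝ) 1) (ht : t ∈ Icc (0:ℝ) 1) :
    IntervalIntegrable (fun u => G (v u) (ψ u)) volume s t := by
  apply h.int.mono_set
  rw [uIcc_of_le zero_le_one]
  exact uIcc_subset_Icc hs ht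

lemma IsPath.sub {v : ℝ → V} {x : Euc d} {ψ : ℝ → Euc d} (h : IsPath Ω G v x ψ) {s t : ℝ}
    (hs : s ∈ Icc (0:ℝ) 1) (ht : t ∈ Icc (0:ℝ) 1) :
    ψ t - ψ s = ∫ u in s..t, G (v u) (ψ u) := by
  rw [h.eq t ht, h.eq s hs, add_sub_add_left_eq_sub]
  exact intervalIntegral.integral_interval_sub_left (h.int' (by simp) ht) (h.int' (by simp) hs)

lemma IsPath.zero {v : ℝ → V} {x : Euc d} {ψ : ℝ → Euc d} (h : IsPath Ω G v x ψ) : ψ 0 = x := by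
  rw [h.eq 0 (by simp)]; simp

lemma int_mono1 [MeasurableSpace V] [BorelSpace V] {v : ℝ → V} (hv : InV01 v) {c B : ℝ}
    (hc : 0 ≤ c) (hB : ∫ u in (0:ℝ)..1, ‖v u‖ ≤ B) {t : ℝ} (ht : t ∈ Icc (0:ℝ) 1) :
    ∫ u in (0:ℝ)..t, c * ‖v u‖ ≤ c * B := by
  rw [intervalIntegral.integral_const_mul]
  apply mul_le_mul_of_nonneg_left _ hc
  refine le_trans ?_ hB
  apply intervalIntegral.integral_mono_interval le_rfl ht.1 ht.2
  · filter_upwards with u; positivity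
  · exact (int1 hv (by simp) (by simp)).1

lemma path_lip [MeasurableSpace V] [BorelSpace V]
    (hG : GoodG Ω c G) {v : ℝ → V} (hv : InV01 v) {B : ℝ} (hB : ∫ u in (0:ℝ)..1, ‖v u‖ ≤ B)
    {x1 x2 : Euc d} {ψ1 ψ2 : ℝ → Euc d} (h1 : IsPath Ω G v x1 ψ1) (h2 : IsPath Ω G v x2 ψ2) :
    (∀ t ∈ Icc (0:ℝ) 1, ‖ψ1 t - ψ2 t‖ ≤ ‖x1 - x2‖ * Real.exp (c * B)) ∧
    ‖x1 - x2‖ ≤ ‖ψ1 1 - ψ2 1‖ * Real.exp (c * B) := by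
  have hia : IntervalIntegrable (fun u => c * ‖v u‖) volume 0 1 :=
    (int1 hv (by simp) (by simp)).1.const_mul c
  have hyc : ContinuousOn (fun u => ‖ψ1 u - ψ2 u‖) (Icc 0 1) := (h1.cont.sub h2.cont).norm
  have hay : ∀ s ∈ Icc (0:ℝ) 1, ∀ t ∈ Icc (0:ℝ) 1,
      IntervalIntegrable (fun u => c * ‖v u‖ * ‖ψ1 u - ψ2 u‖) volume s t := by
    intro s hs t ht
    refine (hia.mul_continuousOn (by rw [uIcc_of_le zero_le_one]; exact hyc)).mono_set ?_
    rw [uIcc_of_le zero_le_one]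
    exact uIcc_subset_Icc hs ht
  have key : ∀ s ∈ Icc (0:ℝ) 1, ∀ t ∈ Icc (0:ℝ) 1, s ≤ t →
      ‖(ψ1 t - ψ2 t) - (ψ1 s - ψ2 s)‖ ≤ ∫ u in s..t, c * ‖v u‖ * ‖ψ1 u - ψ2 u‖ := by
    intro s hs t ht hst
    have e : (ψ1 t - ψ2 t) - (ψ1 s - ψ2 s) = ∫ u in s..t, (G (v u) (ψ1 u) - G (v u) (ψ2 u)) := by
      rw [intervalIntegral.integral_sub (h1.int' hs ht) (h2.int' hs ht), ← h1.sub hs ht,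
        ← h2.sub hs ht]
      abel
    rw [e]
    apply intervalIntegral.norm_integral_le_of_norm_le hst _ (hay s hs t ht)
    filter_upwards with u _
    exact hG.lip _ _ _
  have z1 := h1.zero
  have z2 := h2.zero
  constructor
  · intro t ht
    have := gron (a := fun u => c * ‖v u‖) (y := fun u => ‖ψ1 u - ψ2 u‖) (A := ‖x1 - x2‖) (T := 1)
      (norm_nonneg _) zero_le_one (fun t => mul_nonneg hG.c0 (norm_nonneg _)) hia hyc (by
        intro t ht
        have := key 0 (by simp) t ht ht.1
        rw [z1, z2] at this
        have h3 := norm_sub_norm_le (ψ1 t - ψ2 t) (x1 - x2)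
        linarith) t ht
    exact this.trans (mul_le_mul_of_nonneg_left (Real.exp_le_exp.2 (int_mono1 hv hG.c0 hB ht))
      (norm_nonneg _))
  · have := gron_back (a := fun u => c * ‖v u‖) (y := fun u => ‖ψ1 u - ψ2 u‖)
      (A := ‖ψ1 1 - ψ2 1‖) (T := 1)
      (norm_nonneg _) zero_le_one (fun t => mul_nonneg hG.c0 (norm_nonneg _)) hia hyc (by
        intro t ht
        have := key t ht 1 (by simp) ht.2
        rw [norm_sub_rev] at this
        have h3 := norm_sub_norm_le (ψ1 t - ψ2 t) (ψ1 1 - ψ2 1)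
        linarith)
    rw [z1, z2] at this
    exact this.trans (mul_le_mul_of_nonneg_left
      (Real.exp_le_exp.2 (int_mono1 hv hG.c0 hB (by simp))) (norm_nonneg _))

lemma path_comb [MeasurableSpace V] [BorelSpace V]
    (hG : GoodG Ω c G) {v : ℝ → V} (hv : InV01 v) {B : ℝ} (hB : ∫ u in (0:ℝ)..1, ‖v u‖ ≤ B)
    {J : Type*} [Fintype J] (a : J → ℝ) (h : J → Euc d) (ha : ∑ j, a j • h j = 0)
    {x : Euc d} {ψ : ℝ → Euc d} {ψj : J → ℝ → Euc d} (hψ : IsPath Ω G v x ψ)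
    (hψj : ∀ j, IsPath Ω G v (x + h j) (ψj j)) :
    ‖∑ j, a j • (ψj j 1 - ψ 1)‖ ≤
      c * B * Real.exp (c * B) ^ 3 * ∑ j, |a j| * ‖h j‖ ^ 2 := by
  set K := Real.exp (c * B) with hK
  have hK0 : 0 < K := Real.exp_pos _
  set S := ∑ j, |a j| * ‖h j‖ ^ 2 with hS
  have hS0 : 0 ≤ S := Finset.sum_nonneg (fun j _ => by positivity)
  have hB0 : 0 ≤ B := le_trans (intervalIntegral.integral_nonneg zero_le_one
    (fun u _ => norm_nonneg _)) hB
  set w : ℝ → Euc d := fun t => ∑ j, a j • (ψj j t - ψ t) with hw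
  have hwc : ContinuousOn w (Icc 0 1) :=
    continuousOn_finsetSum _ (fun j _ => ((hψj j).cont.sub hψ.cont).const_smul (a j))
  have hia : IntervalIntegrable (fun u => c * ‖v u‖) volume 0 1 :=
    (int1 hv (by simp) (by simp)).1.const_mul c
  have hi1 : ∀ t ∈ Icc (0:ℝ) 1, IntervalIntegrable (fun u => c * ‖v u‖) volume 0 t :=
    fun t ht => (int1 hv (by simp) ht).1.const_mul c
  have hi2 : ∀ t ∈ Icc (0:ℝ) 1, IntervalIntegrable (fun u => c * ‖v u‖ * ‖w u‖) volume 0 t := by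
    intro t ht
    apply (hi1 t ht).mul_continuousOn
    rw [uIcc_of_le ht.1]
    exact hwc.norm.mono (Icc_subset_Icc_right ht.2)
  have e : ∀ t ∈ Icc (0:ℝ) 1, w t = ∫ u in (0:ℝ)..t, ∑ j, a j • (G (v u) (ψj j u) - G (v u) (ψ u)) := by
    intro t ht
    have i0 : ∀ j, IntervalIntegrable (fun u => G (v u) (ψj j u) - G (v u) (ψ u)) volume 0 t :=
      fun j => ((hψj j).int' (by simp) ht).sub (hψ.int' (by simp) ht)
    have i1 : ∀ j ∈ (Finset.univ : Finset J), IntervalIntegrable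
        (fun u => a j • (G (v u) (ψj j u) - G (v u) (ψ u))) volume 0 t :=
      fun j _ => (i0 j).smul (a j)
    rw [intervalIntegral.integral_finsetSum i1]
    have : ∀ j, ∫ u in (0:ℝ)..t, a j • (G (v u) (ψj j u) - G (v u) (ψ u)) =
        a j • (ψj j t - ψ t) - a j • h j := by
      intro j
      rw [intervalIntegral.integral_smul, intervalIntegral.integral_sub
        ((hψj j).int' (by simp) ht) (hψ.int' (by simp) ht), ← (hψj j).sub (by simp) ht,
        ← hψ.sub (by simp) ht, (hψj j).zero, hψ.zero, ← smul_sub]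
      congr 1; abel
    simp only [this, Finset.sum_sub_distrib, ha, sub_zero, hw]
  have bd : ∀ u ∈ Icc (0:ℝ) 1, ‖∑ j, a j • (G (v u) (ψj j u) - G (v u) (ψ u))‖ ≤
      c * ‖v u‖ * ‖w u‖ + c * ‖v u‖ * (K ^ 2 * S) := by
    intro u hu
    obtain ⟨D, hD, hD2⟩ := hG.tay (v u) (ψ u)
    have e1 : ∑ j, a j • (G (v u) (ψj j u) - G (v u) (ψ u)) = D (w u) +
        ∑ j, a j • (G (v u) (ψj j u) - G (v u) (ψ u) - D (ψj j u - ψ u)) := by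
      simp only [hw, map_sum, map_smul]
      rw [← Finset.sum_add_distrib]
      apply Finset.sum_congr rfl
      intro j _
      rw [← smul_add]; congr 1; abel
    rw [e1]
    refine (norm_add_le _ _).trans (add_le_add ?_ ?_)
    · exact (D.le_opNorm _).trans (mul_le_mul_of_nonneg_right hD (norm_nonneg _))
    · refine (norm_sum_le _ _).trans ?_
      rw [hS, Finset.mul_sum, Finset.mul_sum]
      apply Finset.sum_le_sum
      intro j _
      rw [norm_smul, Real.norm_eq_abs]
      have l := (path_lip hG hv hB (hψj j) hψ).1 u hu
      rw [add_sub_cancel_left] at l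
      have l2 : ‖ψj j u - ψ u‖ ^ 2 ≤ (‖h j‖ * K) ^ 2 := by gcongr
      have hcv : 0 ≤ c * ‖v u‖ := mul_nonneg hG.c0 (norm_nonneg _)
      calc |a j| * ‖G (v u) (ψj j u) - G (v u) (ψ u) - D (ψj j u - ψ u)‖
          ≤ |a j| * (c * ‖v u‖ * (‖h j‖ * K) ^ 2) := by
            gcongr
            exact (hD2 _).trans (mul_le_mul_of_nonneg_left l2 hcv)
        _ = _ := by ring
  have g := gron (a := fun u => c * ‖v u‖) (y := fun u => ‖w u‖) (A := c * B * (K ^ 2 * S)) (T := 1)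
      (mul_nonneg (mul_nonneg hG.c0 hB0) (by positivity)) zero_le_one
      (fun t => mul_nonneg hG.c0 (norm_nonneg _)) hia hwc.norm (by
        intro t ht
        have h1 : ‖w t‖ ≤ ∫ u in (0:ℝ)..t, (c * ‖v u‖ * ‖w u‖ + c * ‖v u‖ * (K ^ 2 * S)) := by
          rw [e t ht]
          apply intervalIntegral.norm_integral_le_of_norm_le ht.1 _
            ((hi2 t ht).add ((hi1 t ht).mul_const _))
          filter_upwards with u hu
          exact bd u ⟨hu.1.le, hu.2.trans ht.2⟩
        rw [intervalIntegral.integral_add (hi2 t ht) ((hi1 t ht).mul_const _),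
          intervalIntegral.integral_mul_const] at h1
        have h2 := mul_le_mul_of_nonneg_right (int_mono1 hv hG.c0 hB ht)
          (show 0 ≤ K ^ 2 * S by positivity)
        linarith) 1 (by simp)
  calc _ ≤ _ := g
    _ ≤ c * B * (K ^ 2 * S) * K := by
      apply mul_le_mul_of_nonneg_left (Real.exp_le_exp.2 (int_mono1 hv hG.c0 hB (by simp)))
      exact (mul_nonneg (mul_nonneg hG.c0 hB0) (by positivity))
    _ = _ := by ring

end

lemma ulim {X : Type*} [NormedAddCommGroup X] [ProperSpace X] (F : Ultrafilter ℕ)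
    (u : ℕ → X) {R : ℝ} (hu : ∀ n, ‖u n‖ ≤ R) :
    ∃ L, ‖L‖ ≤ R ∧ Tendsto u F (𝓝 L) := by
  have h := (isCompact_closedBall (0:X) R).ultrafilter_le_nhds (F.map u) (by
    simp only [le_principal_iff, Ultrafilter.mem_coe, Ultrafilter.mem_map]
    apply Filter.univ_mem'
    intro n
    simpa using hu n)
  obtain ⟨L, hL, hL2⟩ := h
  exact ⟨L, by simpa using hL, hL2⟩

lemma hasFDerivAt_of_quad {E F : Type*} [NormedAddCommGroup E] [NormedSpace ℝ E]
    [NormedAddCommGroup F] [NormedSpace ℝ F] {f : E → F} {x : E} {L : E →L[ℝ] F} {r M : ℝ}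
    (hr : 0 < r) (h : ∀ h, ‖h‖ < r → ‖f (x + h) - f x - L h‖ ≤ M * ‖h‖ ^ 2) :
    HasFDerivAt f L x := by
  rw [hasFDerivAt_iff_isLittleO_nhds_zero]
  have hO : (fun h => f (x + h) - f x - L h) =O[𝓝 0] fun h : E => ‖h‖ ^ 2 := by
    apply Asymptotics.IsBigO.of_bound M
    filter_upwards [Metric.ball_mem_nhds (0:E) hr] with y hy
    simpa using h y (by simpa using hy)
  have := Asymptotics.isLittleO_pow_sub_sub (0:E) (show 1 < 2 by norm_num)
  simp only [sub_zero] at this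
  exact hO.trans_isLittleO this

lemma diff_of_comb {d : ℕ} {f : Euc d → Euc d} {x : Euc d} {r K M : ℝ} (hr : 0 < r) (hM : 0 ≤ M)
    (hlip : ∀ h, ‖h‖ < r → ‖f (x + h) - f x‖ ≤ ‖h‖ * K)
    (hcomb : ∀ (a : Option (Fin d) → ℝ) (h : Option (Fin d) → Euc d), (∀ j, ‖h j‖ < r) →
      ∑ j, a j • h j = 0 → ‖∑ j, a j • (f (x + h j) - f x)‖ ≤ M * ∑ j, |a j| * ‖h j‖ ^ 2) :
    ∃ L : Euc d →L[ℝ] Euc d, ∀ h, ‖h‖ < r → ‖f (x + h) - f x - L h‖ ≤ M * ‖h‖ ^ 2 := by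
  set ε : ℕ → ℝ := fun m => (r / 2) / (m + 1) with hε
  have hε0 : ∀ m, 0 < ε m := fun m => by simp only [hε]; positivity
  have hεr : ∀ m, ε m < r := by
    intro m
    have : ε m ≤ r / 2 := div_le_self (by positivity) (by linarith [(Nat.cast_nonneg m : (0:ℝ) ≤ m)])
    linarith
  have hεt : Tendsto ε atTop (𝓝 0) := by
    have := (tendsto_one_div_add_atTop_nhds_zero_nat (𝕜 := ℝ)).const_mul (r / 2)
    simpa [hε, div_eq_mul_inv] using this
  set e : Fin d → Euc d := fun i => EuclideanSpace.single i (1:ℝ) with he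
  have hen : ∀ i, ‖e i‖ = 1 := fun i => by simp [he]
  have hee : ∀ m i, ‖ε m • e i‖ = ε m := fun m i => by
    rw [norm_smul, hen, mul_one, Real.norm_of_nonneg (hε0 m).le]
  set L : ℕ → Euc d →L[ℝ] Euc d := fun m => ∑ i : Fin d,
    (EuclideanSpace.proj i : Euc d →L[ℝ] ℝ).smulRight ((ε m)⁻¹ • (f (x + ε m • e i) - f x)) with hL
  have hLa : ∀ m h, L m h = ∑ i, h i • ((ε m)⁻¹ • (f (x + ε m • e i) - f x)) := by
    intro m h; simp [hL]
  have hK : ∀ m, ‖L m‖ ≤ d * |K| := by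
    intro m
    apply ContinuousLinearMap.opNorm_le_bound _ (by positivity)
    intro h
    rw [hLa]
    calc _ ≤ ∑ i : Fin d, ‖h‖ * |K| := by
          apply norm_sum_le_of_le
          intro i _
          rw [norm_smul, norm_smul]
          have h1 : ‖h i‖ ≤ ‖h‖ := PiLp.norm_apply_le h i
          have h2 := hlip (ε m • e i) (by rw [hee]; exact hεr m)
          rw [hee] at h2
          have h3 : ‖(ε m)⁻¹‖ * ‖f (x + ε m • e i) - f x‖ ≤ |K| := by
            rw [norm_inv, Real.norm_of_nonneg (hε0 m).le, inv_mul_le_iff₀ (hε0 m)]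
            exact h2.trans (mul_le_mul_of_nonneg_left (le_abs_self K) (hε0 m).le)
          exact mul_le_mul h1 h3 (by positivity) (by positivity)
      _ = _ := by simp; ring
  have : ProperSpace (Euc d →L[ℝ] Euc d) := FiniteDimensional.proper ℝ _
  obtain ⟨L0, -, hL0⟩ := ulim (hyperfilter ℕ) L hK
  refine ⟨L0, fun h hh => ?_⟩
  have hsum : h = ∑ i, h i • e i := by
    have := (EuclideanSpace.basisFun (Fin d) ℝ).sum_repr h
    simpa [he] using this.symm
  have bd : ∀ m, ‖f (x + h) - f x - L m h‖ ≤ M * (‖h‖ ^ 2 + ε m * ∑ i, |h i|) := by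
    intro m
    have := hcomb (fun j => j.elim 1 (fun i => -(h i * (ε m)⁻¹))) (fun j => j.elim h (fun i => ε m • e i))
      (by rintro (_ | i)
          · exact hh
          · simpa [hee] using hεr m)
      (by rw [Fintype.sum_option]
          simp only [Option.elim]
          have : ∀ i, -(h i * (ε m)⁻¹) • ε m • e i = - (h i • e i) := by
            intro i
            rw [smul_smul, ← neg_smul]
            congr 1
            have := (hε0 m).ne'
            field_simp
          simp only [this, Finset.sum_neg_distrib, ← hsum]
          simp)
    rw [Fintype.sum_option, Fintype.sum_option] at this
    simp only [Option.elim, one_smul, abs_one, one_mul] at this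
    have e1 : f (x + h) - f x - L m h =
      f (x + h) - f x + ∑ i, -(h i * (ε m)⁻¹) • (f (x + ε m • e i) - f x) := by
      rw [hLa, sub_eq_add_neg, ← Finset.sum_neg_distrib]
      congr 1
      apply Finset.sum_congr rfl
      intro i _
      rw [smul_smul, neg_smul]
    rw [e1]
    refine this.trans_eq ?_
    congr 2
    rw [Finset.mul_sum]
    apply Finset.sum_congr rfl
    intro i _
    rw [hee, abs_neg, abs_mul, abs_inv, abs_of_pos (hε0 m)]
    have := (hε0 m).ne'
    field_simp
  have hle : ((hyperfilter ℕ : Ultrafilter ℕ) : Filter ℕ) ≤ atTop := Nat.hyperfilter_le_atTop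
  have t1 : Tendsto (fun m => ‖f (x + h) - f x - L m h‖) (hyperfilter ℕ)
      (𝓝 ‖f (x + h) - f x - L0 h‖) := by
    apply Tendsto.norm
    apply Tendsto.const_sub
    exact ((ContinuousLinearMap.apply ℝ (Euc d) h).continuous.tendsto L0).comp hL0
  have t2 : Tendsto (fun m => M * (‖h‖ ^ 2 + ε m * ∑ i, |h i|)) (hyperfilter ℕ)
      (𝓝 (M * (‖h‖ ^ 2 + 0 * ∑ i, |h i|))) :=
    (((hεt.mono_left hle).mul_const _).const_add _).const_mul _
  rw [zero_mul, add_zero] at t2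
  exact le_of_tendsto_of_tendsto' t1 t2 bd

lemma det_le_pow {d : ℕ} (L : Euc d →L[ℝ] Euc d) {K : ℝ} (hK0 : 0 < K) (hK : ‖L‖ ≤ K) :
    |L.det| ≤ K ^ d := by
  have h1 := Measure.addHaar_image_continuousLinearMap (volume : Measure (Euc d)) L
    (Metric.ball 0 1)
  have h2 : L '' (Metric.ball 0 1) ⊆ Metric.ball 0 K := by
    rintro _ ⟨y, hy, rfl⟩
    rw [mem_ball_zero_iff] at hy ⊢
    calc ‖L y‖ ≤ ‖L‖ * ‖y‖ := L.le_opNorm y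
      _ ≤ K * ‖y‖ := by gcongr
      _ < K := by nlinarith
  have h3 := measure_mono (μ := (volume : Measure (Euc d))) h2
  rw [h1, Measure.addHaar_ball_of_pos _ _ hK0] at h3
  have h4 : volume (Metric.ball (0 : Euc d) 1) ≠ 0 := (Metric.measure_ball_pos _ _ one_pos).ne'
  have h5 : volume (Metric.ball (0 : Euc d) 1) ≠ ⊤ := measure_ball_lt_top.ne
  rw [ENNReal.mul_le_mul_iff_left h4 h5] at h3
  rw [ENNReal.ofReal_le_ofReal_iff (by positivity)] at h3
  simpa using h3

lemma det_ne_zero {d : ℕ} {f : Euc d → Euc d} {x : Euc d} {L : Euc d →L[ℝ] Euc d} {r M K : ℝ}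
    (hr : 0 < r) (hK : 0 < K) (hL : ∀ h, ‖h‖ < r → ‖f (x + h) - f x - L h‖ ≤ M * ‖h‖ ^ 2)
    (hlow : ∀ h, ‖h‖ < r → ‖h‖ ≤ ‖f (x + h) - f x‖ * K) : L.det ≠ 0 := by
  have hinj : ∀ h, L h = 0 → h = 0 := by
    intro h hh
    by_contra hne
    have hpos : 0 < ‖h‖ := norm_pos_iff.2 hne
    have key : ∀ᶠ s in 𝓝[>] (0:ℝ), ‖h‖ ≤ s * (M * ‖h‖ ^ 2 * K) := by
      have : ∀ᶠ s in 𝓝[>] (0:ℝ), s < r / ‖h‖ :=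
        mem_nhdsWithin_of_mem_nhds (Iio_mem_nhds (by positivity))
      filter_upwards [this, self_mem_nhdsWithin] with s hs hs0
      simp only [mem_Ioi] at hs0
      have hn : ‖s • h‖ = s * ‖h‖ := by rw [norm_smul, Real.norm_of_nonneg hs0.le]
      have hsr : ‖s • h‖ < r := by rw [hn]; exact (lt_div_iff₀ hpos).1 hs
      have h1 := hL _ hsr
      have h2 := hlow _ hsr
      rw [map_smul, hh, smul_zero, sub_zero] at h1
      have h3 := h2.trans (mul_le_mul_of_nonneg_right h1 hK.le)
      rw [hn] at h3
      have : s * ‖h‖ ≤ s * (s * (M * ‖h‖ ^ 2 * K)) := by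
        calc _ ≤ _ := h3
          _ = _ := by ring
      exact le_of_mul_le_mul_left this hs0
    have t : Tendsto (fun s : ℝ => s * (M * ‖h‖ ^ 2 * K)) (𝓝[>] 0) (𝓝 (0 * (M * ‖h‖ ^ 2 * K))) :=
      (tendsto_nhdsWithin_of_tendsto_nhds tendsto_id).mul_const _
    have := ge_of_tendsto t key
    rw [zero_mul] at this
    linarith
  have : Function.Injective (L : Euc d →ₗ[ℝ] Euc d) :=
    (injective_iff_map_eq_zero _).2 hinj
  have h2 : LinearMap.ker (L : Euc d →ₗ[ℝ] Euc d) = ⊥ := LinearMap.ker_eq_bot.2 this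
  intro h0
  exact absurd (LinearMap.bot_lt_ker_of_det_eq_zero (f := (L : Euc d →ₗ[ℝ] Euc d)) h0)
    (by rw [h2]; exact lt_irrefl _)

section
variable {d : ℕ} {V : Type*} [NormedAddCommGroup V] [InnerProductSpace ℝ V]
  {Ω : Set (Euc d)} {c : ℝ} {G : V → Euc d → Euc d}

lemma flow_deriv [MeasurableSpace V] [BorelSpace V]
    (hG : GoodG Ω c G) {v : ℝ → V} (hv : InV01 v) {B : ℝ} (hB : ∫ u in (0:ℝ)..1, ‖v u‖ ≤ B)
    {φ : ℝ → Euc d → Euc d} (hφ : ∀ y ∈ Ω, IsPath Ω G v y (fun t => φ t y)) {x : Euc d} {r : ℝ}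
    (hr : 0 < r) (hball : ∀ h, ‖h‖ < r → x + h ∈ Ω) :
    ∃ L : Euc d →L[ℝ] Euc d, fderiv ℝ (φ 1) x = L ∧ ‖L‖ ≤ Real.exp (c * B) ∧
      (∀ h, ‖h‖ < r → ‖φ 1 (x + h) - φ 1 x - L h‖ ≤ c * B * Real.exp (c * B) ^ 3 * ‖h‖ ^ 2) ∧
      (∀ h, ‖h‖ < r → ‖h‖ ≤ ‖φ 1 (x + h) - φ 1 x‖ * Real.exp (c * B)) := by
  have hx : x ∈ Ω := by simpa using hball 0 (by simpa using hr)
  have hB0 : 0 ≤ B := le_trans (intervalIntegral.integral_nonneg zero_le_one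
    (fun u _ => norm_nonneg _)) hB
  have hlip : ∀ h, ‖h‖ < r → ‖φ 1 (x + h) - φ 1 x‖ ≤ ‖h‖ * Real.exp (c * B) := by
    intro h hh
    have := (path_lip hG hv hB (hφ (x + h) (hball h hh)) (hφ x hx)).1 1 ⟨zero_le_one, le_rfl⟩
    rwa [add_sub_cancel_left] at this
  obtain ⟨L, hL⟩ := diff_of_comb (f := φ 1) (x := x) (K := Real.exp (c * B)) hr
    (M := c * B * Real.exp (c * B) ^ 3)
    (mul_nonneg (mul_nonneg hG.c0 hB0) (by positivity)) hlip (by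
      intro a h hh ha
      exact path_comb hG hv hB a h ha (ψ := fun t => φ t x) (ψj := fun j t => φ t (x + h j))
        (hφ x hx) (fun j => hφ _ (hball _ (hh j))))
  have hd := hasFDerivAt_of_quad hr hL
  refine ⟨L, hd.fderiv, ?_, hL, ?_⟩
  · apply hd.le_of_lip' (Real.exp_pos _).le
    filter_upwards [Metric.ball_mem_nhds x hr] with y hy
    have := hlip (y - x) (by rwa [mem_ball_iff_norm] at hy)
    rw [add_sub_cancel] at this
    linarith
  · intro h hh
    have := (path_lip hG hv hB (hφ (x + h) (hball h hh)) (hφ x hx)).2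
    rwa [add_sub_cancel_left] at this
end

/-- weak ultralimits of bounded sequences in Hilbert space -/
lemma weak_ulim {W : Type*} [NormedAddCommGroup W] [InnerProductSpace ℝ W] [CompleteSpace W]
    (F : Ultrafilter ℕ) (f : ℕ → W) {R : ℝ} (hf : ∀ n, ‖f n‖ ≤ R) :
    ∃ w : W, ∀ g : W, Tendsto (fun n => ⟪f n, g⟫) F (𝓝 ⟪w, g⟫) := by
  have h : ∀ g, ∃ l : ℝ, ‖l‖ ≤ R * ‖g‖ ∧ Tendsto (fun n => ⟪f n, g⟫) F (𝓝 l) := fun g =>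
    ulim F (fun n => ⟪f n, g⟫) (fun n => (norm_inner_le_norm _ _).trans
      (mul_le_mul_of_nonneg_right (hf n) (norm_nonneg _)))
  choose l hl1 hl2 using h
  let ℓ : W →ₗ[ℝ] ℝ :=
    { toFun := l
      map_add' := fun a b => tendsto_nhds_unique (hl2 (a + b)) (by
        simpa only [inner_add_right] using (hl2 a).add (hl2 b))
      map_smul' := fun a b => tendsto_nhds_unique (hl2 (a • b)) (by
        simpa only [inner_smul_right, RingHom.id_apply, smul_eq_mul] using (hl2 b).const_mul a) }
  let ℓc : StrongDual ℝ W := ℓ.mkContinuous R hl1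
  refine ⟨(InnerProductSpace.toDual ℝ W).symm ℓc, fun g => ?_⟩
  rw [InnerProductSpace.toDual_symm_apply]
  exact hl2 g

lemma euc_sum {d : ℕ} (h : Euc d) : h = ∑ i, h i • EuclideanSpace.single i (1:ℝ) := by
  have := (EuclideanSpace.basisFun (Fin d) ℝ).sum_repr h
  simpa using this.symm

lemma weak_map {d : ℕ} {W : Type*} [NormedAddCommGroup W] [InnerProductSpace ℝ W] [CompleteSpace W]
    {F : Filter ℕ} {f : ℕ → W} {w : W} (h : ∀ g : W, Tendsto (fun n => ⟪f n, g⟫) F (𝓝 ⟪w, g⟫))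
    (T : W →L[ℝ] Euc d) : Tendsto (fun n => T (f n)) F (𝓝 (T w)) := by
  have h1 : ∀ i, Tendsto (fun n => T (f n) i) F (𝓝 (T w i)) := by
    intro i
    let ℓ : StrongDual ℝ W := (EuclideanSpace.proj i : Euc d →L[ℝ] ℝ).comp T
    have h2 : ∀ z, T z i = ⟪z, (InnerProductSpace.toDual ℝ W).symm ℓ⟫ := by
      intro z
      rw [real_inner_comm, InnerProductSpace.toDual_symm_apply]; rfl
    simp only [h2]
    exact h _
  have h2 : ∀ z, T z = ∑ i, T z i • EuclideanSpace.single i (1:ℝ) := fun z => euc_sum _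
  rw [h2 w]
  refine Tendsto.congr (fun n => (h2 (f n)).symm) ?_
  exact tendsto_finsetSum _ (fun i _ => (h1 i).smul_const _)

abbrev mu01 : Measure ℝ := volume.restrict (Ioc (0:ℝ) 1)

instance : IsProbabilityMeasure mu01 := ⟨by simp⟩

section
variable {d : ℕ} {V : Type*} [NormedAddCommGroup V] [InnerProductSpace ℝ V] [CompleteSpace V]
  [MeasurableSpace V] [BorelSpace V] [SecondCountableTopology V]
  {Ω : Set (Euc d)} {c : ℝ} {G : V → Euc d → Euc d}

lemma lp_int (g : Lp V 2 mu01) : Integrable (fun u => ‖g u‖) mu01 ∧ ∫ u, ‖g u‖ ∂mu01 ≤ ‖g‖ := by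
  have h1 : MemLp g 1 mu01 := (Lp.memLp g).mono_exponent (by norm_num)
  refine ⟨(memLp_one_iff_integrable.1 h1).norm, ?_⟩
  rw [integral_norm_eq_lintegral_enorm h1.1, Lp.norm_def, ← eLpNorm_one_eq_lintegral_enorm]
  exact ENNReal.toReal_mono (Lp.memLp g).2.ne
    (eLpNorm_le_eLpNorm_of_exponent_le (by norm_num) h1.1)

lemma exists_T (hG : GoodG Ω c G) {ψ : ℝ → Euc d} (hψ : ContinuousOn ψ (Icc 0 1)) {t : ℝ}
    (ht : t ∈ Icc (0:ℝ) 1) : ∃ T : Lp V 2 mu01 →L[ℝ] Euc d,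
      ∀ g : Lp V 2 mu01, T g = ∫ u in Ioc 0 t, G (g u) (ψ u) := by
  have hsub : Ioc 0 t ⊆ Ioc 0 1 := Ioc_subset_Ioc_right ht.2
  have hle : volume.restrict (Ioc 0 t) ≤ mu01 := Measure.restrict_mono_set _ hsub
  have hac : volume.restrict (Ioc 0 t) ≪ mu01 := hle.absolutelyContinuous
  have hψm : AEStronglyMeasurable ψ (volume.restrict (Ioc 0 t)) :=
    (hψ.mono (fun u hu => ⟨hu.1.le, hu.2.trans ht.2⟩)).aestronglyMeasurable measurableSet_Ioc
  have hint : ∀ g : Lp V 2 mu01, IntegrableOn (fun u => G (g u) (ψ u)) (Ioc 0 t) := by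
    intro g
    have hm : AEStronglyMeasurable (fun u => G (g u) (ψ u)) (volume.restrict (Ioc 0 t)) :=
      hG.cont.comp_aestronglyMeasurable ((Lp.stronglyMeasurable g).aestronglyMeasurable.prodMk hψm)
    apply Integrable.mono' (((lp_int g).1.mono_measure hle).const_mul c) hm
    filter_upwards with u
    exact hG.b0 _ _
  let T0 : Lp V 2 mu01 →ₗ[ℝ] Euc d :=
    { toFun := fun g => ∫ u in Ioc 0 t, G (g u) (ψ u)
      map_add' := fun a b => by
        rw [← integral_add (hint a) (hint b)]
        apply integral_congr_ae
        filter_upwards [hac.ae_le (Lp.coeFn_add a b)] with u hu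
        rw [hu, Pi.add_apply, hG.add]
      map_smul' := fun r a => by
        rw [RingHom.id_apply, ← integral_smul]
        apply integral_congr_ae
        filter_upwards [hac.ae_le (Lp.coeFn_smul r a)] with u hu
        rw [hu, Pi.smul_apply, hG.smul] }
  refine ⟨T0.mkContinuous c ?_, fun g => rfl⟩
  intro g
  change ‖∫ u in Ioc 0 t, G (g u) (ψ u)‖ ≤ _
  calc _ ≤ ∫ u in Ioc 0 t, c * ‖g u‖ := by
        apply norm_integral_le_of_norm_le (((lp_int g).1.mono_measure hle).const_mul c)
        filter_upwards with u
        exact hG.b0 _ _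
    _ ≤ ∫ u, c * ‖g u‖ ∂mu01 := by
        apply integral_mono_measure hle
        · filter_upwards with u; exact mul_nonneg hG.c0 (norm_nonneg _)
        · exact (lp_int g).1.const_mul c
    _ = c * ∫ u, ‖g u‖ ∂mu01 := integral_const_mul _ _
    _ ≤ _ := mul_le_mul_of_nonneg_left (lp_int g).2 hG.c0

lemma normsq_lp (g : Lp V 2 mu01) : ‖g‖ ^ 2 = ∫ u in (0:ℝ)..1, ‖g u‖ ^ 2 := by
  rw [intervalIntegral.integral_of_le zero_le_one, ← real_inner_self_eq_norm_sq, L2.inner_def]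
  simp only [real_inner_self_eq_norm_sq]

lemma weak_lim (hG : GoodG Ω c G) (F : Ultrafilter ℕ) {v : ℕ → ℝ → V} (hv : ∀ n, InV01 (v n))
    {R : ℝ} (hR : ∀ n, ∫ u in (0:ℝ)..1, ‖v n u‖ ^ 2 ≤ R) :
    ∃ w : ℝ → V, InV01 w ∧ (∀ ψ : ℝ → Euc d, ContinuousOn ψ (Icc 0 1) → ∀ t ∈ Icc (0:ℝ) 1,
      Tendsto (fun n => ∫ u in (0:ℝ)..t, G (v n u) (ψ u)) F
        (𝓝 (∫ u in (0:ℝ)..t, G (w u) (ψ u)))) ∧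
      ∀ ε > 0, ∀ᶠ n in F, ∫ u in (0:ℝ)..1, ‖w u‖ ^ 2 ≤ (∫ u in (0:ℝ)..1, ‖v n u‖ ^ 2) + ε := by
  have hmem : ∀ n, MemLp (v n) 2 mu01 := fun n =>
    (memLp_two_iff_integrable_sq_norm (hv n).1.aestronglyMeasurable).2
      ((hv n).2.mono_set Ioc_subset_Icc_self)
  set f : ℕ → Lp V 2 mu01 := fun n => (hmem n).toLp (v n) with hf
  have hfv : ∀ n, f n =ᵐ[mu01] v n := fun n => (hmem n).coeFn_toLp
  have hfn : ∀ n, ‖f n‖ ^ 2 = ∫ u in (0:ℝ)..1, ‖v n u‖ ^ 2 := by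
    intro n
    rw [normsq_lp, intervalIntegral.integral_of_le zero_le_one,
      intervalIntegral.integral_of_le zero_le_one]
    apply integral_congr_ae
    filter_upwards [hfv n] with u hu
    rw [hu]
  obtain ⟨w, hw⟩ := weak_ulim F f (R := Real.sqrt R) (fun n => by
    apply Real.le_sqrt_of_sq_le; rw [hfn]; exact hR n)
  refine ⟨w, ⟨(Lp.stronglyMeasurable w).measurable, ?_⟩, ?_, ?_⟩
  · rw [integrableOn_Icc_iff_integrableOn_Ioc]
    exact (memLp_two_iff_integrable_sq_norm (Lp.memLp w).1).1 (Lp.memLp w)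
  · intro ψ hψ t ht
    obtain ⟨T, hT⟩ := exists_T (V := V) hG hψ ht
    have := weak_map hw T
    have hac : volume.restrict (Ioc 0 t) ≪ mu01 :=
      (Measure.restrict_mono_set _ (Ioc_subset_Ioc_right ht.2)).absolutelyContinuous
    rw [hT] at this
    rw [intervalIntegral.integral_of_le ht.1]
    refine this.congr (fun n => ?_)
    rw [hT, intervalIntegral.integral_of_le ht.1]
    apply integral_congr_ae
    filter_upwards [hac.ae_le (hfv n)] with u hu
    rw [hu]
  · intro ε hε
    have h1 := hw w
    rw [real_inner_self_eq_norm_sq] at h1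
    have h2 : ∀ᶠ n in (F : Filter ℕ), ‖w‖ ^ 2 - ε / 2 < ⟪f n, w⟫ := h1.eventually_const_lt (by linarith)
    filter_upwards [h2] with n hn
    rw [← normsq_lp, ← hfn]
    have h3 := norm_sub_sq_real (f n) w
    have h4 := sq_nonneg ‖f n - w‖
    linarith
end

section
variable {d : ℕ} {V : Type*} [NormedAddCommGroup V] [InnerProductSpace ℝ V] [CompleteSpace V]
  [MeasurableSpace V] [BorelSpace V] [SecondCountableTopology V]
  {Ω : Set (Euc d)} {c : ℝ} {G : V → Euc d → Euc d}

lemma int_G (hG : GoodG Ω c G) {v : ℝ → V} (hv : InV01 v) {ψ : ℝ → Euc d}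
    (hψ : ContinuousOn ψ (Icc 0 1)) {s t : ℝ} (hs : s ∈ Icc (0:ℝ) 1) (ht : t ∈ Icc (0:ℝ) 1) :
    IntervalIntegrable (fun u => G (v u) (ψ u)) volume s t := by
  have hsub : uIcc s t ⊆ Icc 0 1 := uIcc_subset_Icc hs ht
  have h1 := (int1 hv (s := 0) (t := 1) (by simp) (by simp)).1
  rw [intervalIntegrable_iff_integrableOn_Icc_of_le zero_le_one] at h1
  have h2 : IntegrableOn (fun u => G (v u) (ψ u)) (Icc 0 1) := by
    apply Integrable.mono' (h1.const_mul c)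
    · exact hG.cont.comp_aestronglyMeasurable (hv.1.aestronglyMeasurable.prodMk
        (hψ.aestronglyMeasurable measurableSet_Icc))
    · filter_upwards with u
      exact hG.b0 _ _
  exact (h2.mono_set hsub).intervalIntegrable

lemma int_G_bound (hG : GoodG Ω c G) {v : ℝ → V} (hv : InV01 v) {ψ : ℝ → Euc d}
    {s t η R : ℝ} (hs : 0 ≤ s) (hst : s ≤ t) (ht : t ≤ 1) (hη : 0 < η)
    (hR : ∫ u in (0:ℝ)..1, ‖v u‖ ^ 2 ≤ R) :
    ‖∫ u in s..t, G (v u) (ψ u)‖ ≤ c * (η * R + (t - s) / η) := by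
  have i := (int1 hv (s := s) (t := t) ⟨hs, hst.trans ht⟩ ⟨hs.trans hst, ht⟩).1
  have h1 : ‖∫ u in s..t, G (v u) (ψ u)‖ ≤ ∫ u in s..t, c * ‖v u‖ := by
    apply intervalIntegral.norm_integral_le_of_norm_le hst _ (i.const_mul c)
    filter_upwards with u _
    exact hG.b0 _ _
  rw [intervalIntegral.integral_const_mul] at h1
  have h2 := int1_bound hv hs hst ht hη
  have h3 := mul_le_mul_of_nonneg_left hR hη.le
  exact h1.trans (mul_le_mul_of_nonneg_left (by linarith) hG.c0)

lemma unif_small (hG : GoodG Ω c G) (F : Filter ℕ) {v : ℕ → ℝ → V} (hv : ∀ n, InV01 (v n))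
    {w : ℝ → V} (hw : InV01 w) {R : ℝ} (hR : ∀ n, ∫ u in (0:ℝ)..1, ‖v n u‖ ^ 2 ≤ R)
    (hRw : ∫ u in (0:ℝ)..1, ‖w u‖ ^ 2 ≤ R) {ψ : ℝ → Euc d} (hψ : ContinuousOn ψ (Icc 0 1))
    (hlim : ∀ t ∈ Icc (0:ℝ) 1, Tendsto (fun n => ∫ u in (0:ℝ)..t, G (v n u) (ψ u)) F
        (𝓝 (∫ u in (0:ℝ)..t, G (w u) (ψ u)))) {ε : ℝ} (hε : 0 < ε) :
    ∀ᶠ n in F, ∀ t ∈ Icc (0:ℝ) 1, ‖(∫ u in (0:ℝ)..t, G (v n u) (ψ u)) -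
      ∫ u in (0:ℝ)..t, G (w u) (ψ u)‖ ≤ ε := by
  have hc0 := hG.c0
  have hR0 : 0 ≤ R := le_trans (intervalIntegral.integral_nonneg zero_le_one
    (fun u _ => by positivity)) hRw
  set η : ℝ := ε / (8 * (c * R + 1)) with hηd
  have hη : 0 < η := by positivity
  have hη2 : 2 * (c * (η * R)) ≤ ε / 4 := by
    have : η * (8 * (c * R + 1)) = ε := by rw [hηd]; field_simp
    nlinarith
  obtain ⟨N, hN⟩ := exists_nat_gt (8 * c / (η * ε))
  have hN0 : (0:ℝ) < N := lt_of_le_of_lt (by positivity) hN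
  have hN2 : 2 * (c * ((1 / N) / η)) ≤ ε / 4 := by
    rw [div_lt_iff₀ (by positivity)] at hN
    have : 2 * (c * ((1 / N) / η)) = 2 * c / (N * η) := by field_simp
    rw [this, div_le_iff₀ (by positivity)]
    nlinarith
  have hev : ∀ᶠ n in F, ∀ i ∈ Finset.range (N + 1),
      ‖(∫ u in (0:ℝ)..((i:ℝ) / N), G (v n u) (ψ u)) -
      ∫ u in (0:ℝ)..((i:ℝ) / N), G (w u) (ψ u)‖ < ε / 2 := by
    rw [Filter.eventually_all_finset]
    intro i hi
    have hi1 : (i:ℝ) / N ∈ Icc (0:ℝ) 1 := by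
      refine ⟨by positivity, ?_⟩
      rw [div_le_one hN0]
      exact_mod_cast Nat.lt_succ_iff.1 (Finset.mem_range.1 hi)
    have := tendsto_iff_norm_sub_tendsto_zero.1 (hlim _ hi1)
    exact this.eventually_lt_const (by positivity)
  filter_upwards [hev] with n hn t ht
  set i := ⌊t * N⌋₊ with hi
  have hi1 : (i:ℝ) ≤ t * N := Nat.floor_le (mul_nonneg ht.1 hN0.le)
  have hi2 : t * N < i + 1 := Nat.lt_floor_add_one _
  have hiN : i ∈ Finset.range (N + 1) := by
    rw [Finset.mem_range, Nat.lt_succ_iff]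
    have : (i:ℝ) ≤ N := hi1.trans (mul_le_of_le_one_left hN0.le ht.2)
    exact_mod_cast this
  set s : ℝ := (i:ℝ) / N with hs
  have hs0 : 0 ≤ s := by positivity
  have hst : s ≤ t := by rw [hs, div_le_iff₀ hN0]; exact hi1
  have hts : t - s ≤ 1 / N := by
    rw [hs, le_div_iff₀ hN0, sub_mul, div_mul_cancel₀ _ hN0.ne']; linarith
  have hsm : s ∈ Icc (0:ℝ) 1 := ⟨hs0, hst.trans ht.2⟩
  have h0 := hn i hiN
  have e1 : (∫ u in (0:ℝ)..t, G (v n u) (ψ u)) = (∫ u in (0:ℝ)..s, G (v n u) (ψ u)) +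
      ∫ u in s..t, G (v n u) (ψ u) := (intervalIntegral.integral_add_adjacent_intervals
        (int_G hG (hv n) hψ (by simp) hsm) (int_G hG (hv n) hψ hsm ht)).symm
  have e2 : (∫ u in (0:ℝ)..t, G (w u) (ψ u)) = (∫ u in (0:ℝ)..s, G (w u) (ψ u)) +
      ∫ u in s..t, G (w u) (ψ u) := (intervalIntegral.integral_add_adjacent_intervals
        (int_G hG hw hψ (by simp) hsm) (int_G hG hw hψ hsm ht)).symm
  have b1 := int_G_bound hG (hv n) (ψ := ψ) hs0 hst ht.2 hη (hR n)
  have b2 := int_G_bound hG hw (ψ := ψ) hs0 hst ht.2 hη hRw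
  have b3 : c * (η * R + (t - s) / η) ≤ c * (η * R) + c * ((1 / N) / η) := by
    rw [← mul_add]
    apply mul_le_mul_of_nonneg_left _ hc0
    gcongr
  rw [e1, e2, add_sub_add_comm]
  refine (norm_add_le _ _).trans ?_
  have b4 := norm_sub_le (∫ u in s..t, G (v n u) (ψ u)) (∫ u in s..t, G (w u) (ψ u))
  linarith

lemma flow_conv (hG : GoodG Ω c G) (F : Filter ℕ) {v : ℕ → ℝ → V} (hv : ∀ n, InV01 (v n))
    {w : ℝ → V} (hw : InV01 w) {R : ℝ} (hR : ∀ n, ∫ u in (0:ℝ)..1, ‖v n u‖ ^ 2 ≤ R)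
    (hRw : ∫ u in (0:ℝ)..1, ‖w u‖ ^ 2 ≤ R) {x : Euc d} {ψ : ℝ → Euc d} {ψn : ℕ → ℝ → Euc d}
    (hψ : IsPath Ω G w x ψ) (hψn : ∀ n, IsPath Ω G (v n) x (ψn n))
    (hlim : ∀ t ∈ Icc (0:ℝ) 1, Tendsto (fun n => ∫ u in (0:ℝ)..t, G (v n u) (ψ u)) F
        (𝓝 (∫ u in (0:ℝ)..t, G (w u) (ψ u)))) :
    Tendsto (fun n => ψn n 1) F (𝓝 (ψ 1)) := by
  set K := Real.exp (c * (R + 1)) with hK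
  have hK0 : 0 < K := Real.exp_pos _
  rw [Metric.tendsto_nhds]
  intro ε hε
  filter_upwards [unif_small hG F hv hw hR hRw hψ.cont hlim (ε := ε / (2 * K)) (by positivity)]
    with n hn
  have hia : IntervalIntegrable (fun u => c * ‖v n u‖) volume 0 1 :=
    (int1 (hv n) (by simp) (by simp)).1.const_mul c
  have hyc : ContinuousOn (fun u => ‖ψn n u - ψ u‖) (Icc 0 1) := ((hψn n).cont.sub hψ.cont).norm
  have hB : ∫ u in (0:ℝ)..1, ‖v n u‖ ≤ R + 1 := by
    have := int1_bound (hv n) (s := 0) (t := 1) le_rfl zero_le_one le_rfl one_pos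
    have h2 := hR n
    norm_num at this
    linarith
  have := gron (a := fun u => c * ‖v n u‖) (y := fun u => ‖ψn n u - ψ u‖) (A := ε / (2 * K)) (T := 1)
      (by positivity) zero_le_one (fun t => mul_nonneg hG.c0 (norm_nonneg _)) hia hyc (by
        intro t ht
        have i1 := (hψn n).int' (s := 0) (t := t) (by simp) ht
        have i2 := int_G hG (hv n) hψ.cont (s := 0) (t := t) (by simp) ht
        have e : ψn n t - ψ t = (∫ u in (0:ℝ)..t, (G (v n u) (ψn n u) - G (v n u) (ψ u))) +
            ((∫ u in (0:ℝ)..t, G (v n u) (ψ u)) - ∫ u in (0:ℝ)..t, G (w u) (ψ u)) := by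
          rw [intervalIntegral.integral_sub i1 i2, (hψn n).eq t ht, hψ.eq t ht]
          abel
        have b1 : ‖∫ u in (0:ℝ)..t, (G (v n u) (ψn n u) - G (v n u) (ψ u))‖ ≤
            ∫ u in (0:ℝ)..t, c * ‖v n u‖ * ‖ψn n u - ψ u‖ := by
          apply intervalIntegral.norm_integral_le_of_norm_le ht.1
          · filter_upwards with u _
            exact hG.lip _ _ _
          · refine (hia.mul_continuousOn (by rw [uIcc_of_le zero_le_one]; exact hyc)).mono_set ?_
            rw [uIcc_of_le zero_le_one]
            exact uIcc_subset_Icc (by simp) ht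
        have b2 := hn t ht
        rw [e]
        refine (norm_add_le _ _).trans ?_
        linarith) 1 (by simp)
  have h2 := mul_le_mul_of_nonneg_left (Real.exp_le_exp.2
    (int_mono1 (hv n) hG.c0 hB (t := 1) (by simp))) (show 0 ≤ ε / (2 * K) by positivity)
  have h3 : ε / (2 * K) * K = ε / 2 := by field_simp
  rw [← hK, h3] at h2
  rw [dist_eq_norm]
  linarith
end

section
variable {d : ℕ} {V : Type*} [NormedAddCommGroup V] [InnerProductSpace ℝ V] [CompleteSpace V]
  [MeasurableSpace V] [BorelSpace V] [SecondCountableTopology V]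
  {Ω : Set (Euc d)} {c : ℝ} {G : V → Euc d → Euc d}

lemma ball_in (hG : GoodG Ω c G) {x : Euc d} (hx : x ∈ Ω) :
    ∃ r > 0, ∀ h, ‖h‖ < r → x + h ∈ Ω := by
  obtain ⟨r, hr, hb⟩ := Metric.isOpen_iff.1 hG.op x hx
  exact ⟨r, hr, fun h hh => hb (by simpa [mem_ball_iff_norm] using hh)⟩

lemma logdet_le (hG : GoodG Ω c G) {v : ℝ → V} (hv : InV01 v)
    {φ : ℝ → Euc d → Euc d} (hφ : ∀ y ∈ Ω, IsPath Ω G v y (fun t => φ t y)) {x : Euc d}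
    (hx : x ∈ Ω) :
    Real.log ((fderiv ℝ (φ 1) x).det) ≤ d * c * ∫ u in (0:ℝ)..1, ‖v u‖ := by
  obtain ⟨r, hr, hb⟩ := ball_in hG hx
  obtain ⟨L, h1, h2, -, -⟩ := flow_deriv hG hv le_rfl hφ hr hb
  set B := ∫ u in (0:ℝ)..1, ‖v u‖
  have hB0 : 0 ≤ B := intervalIntegral.integral_nonneg zero_le_one (fun u _ => norm_nonneg _)
  have hc0 := hG.c0
  rw [h1, ← Real.log_abs]
  by_cases h0 : L.det = 0
  · rw [h0, abs_zero, Real.log_zero]; positivity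
  · have := Real.log_le_log (abs_pos.2 h0) (det_le_pow L (Real.exp_pos _) h2)
    rw [Real.log_pow, Real.log_exp] at this
    linarith

lemma term_conv (hG : GoodG Ω c G) (F : Ultrafilter ℕ) {v : ℕ → ℝ → V} (hv : ∀ n, InV01 (v n))
    {w : ℝ → V} (hw : InV01 w) {R : ℝ} (hR : ∀ n, ∫ u in (0:ℝ)..1, ‖v n u‖ ^ 2 ≤ R)
    (hRw : ∫ u in (0:ℝ)..1, ‖w u‖ ^ 2 ≤ R)
    (hlim : ∀ ψ : ℝ → Euc d, ContinuousOn ψ (Icc 0 1) → ∀ t ∈ Icc (0:ℝ) 1,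
      Tendsto (fun n => ∫ u in (0:ℝ)..t, G (v n u) (ψ u)) F
        (𝓝 (∫ u in (0:ℝ)..t, G (w u) (ψ u))))
    {φ : (ℝ → V) → ℝ → Euc d → Euc d}
    (hφ : ∀ v, InV01 v → ∀ y ∈ Ω, IsPath Ω G v y (fun t => φ v t y)) {x : Euc d}
    (hx : x ∈ Ω) {H : Euc d → ℝ} (hH : ContinuousOn H Ω) :
    Tendsto (fun n => Real.log ((fderiv ℝ (φ (v n) 1) x).det) + H (φ (v n) 1 x)) F
      (𝓝 (Real.log ((fderiv ℝ (φ w 1) x).det) + H (φ w 1 x))) := by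
  obtain ⟨r, hr, hb⟩ := ball_in hG hx
  have hB : ∀ z : ℝ → V, InV01 z → ∫ u in (0:ℝ)..1, ‖z u‖ ^ 2 ≤ R → ∫ u in (0:ℝ)..1, ‖z u‖ ≤ R + 1 := by
    intro z hz hzR
    have := int1_bound hz (s := 0) (t := 1) le_rfl zero_le_one le_rfl one_pos
    norm_num at this
    linarith
  have hconv : ∀ y ∈ Ω, Tendsto (fun n => φ (v n) 1 y) F (𝓝 (φ w 1 y)) := fun y hy =>
    flow_conv hG F hv hw hR hRw (hφ w hw y hy) (fun n => hφ (v n) (hv n) y hy)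
      (hlim _ (hφ w hw y hy).cont)
  have hmem : φ w 1 x ∈ Ω := (hφ w hw x hx).mem 1 (by simp)
  refine Tendsto.add ?_ ((hH.continuousAt (hG.op.mem_nhds hmem)).tendsto.comp (hconv x hx))
  have hL := fun n => flow_deriv hG (hv n) (hB _ (hv n) (hR n)) (hφ (v n) (hv n)) hr hb
  choose L hL1 hL2 hL3 hL4 using hL
  have : ProperSpace (Euc d →L[ℝ] Euc d) := FiniteDimensional.proper ℝ _
  obtain ⟨L0, -, hL0⟩ := ulim F L hL2
  have hq : ∀ h, ‖h‖ < r → ‖φ w 1 (x + h) - φ w 1 x - L0 h‖ ≤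
      c * (R + 1) * Real.exp (c * (R + 1)) ^ 3 * ‖h‖ ^ 2 := by
    intro h hh
    have t1 : Tendsto (fun n => ‖φ (v n) 1 (x + h) - φ (v n) 1 x - L n h‖) F
        (𝓝 ‖φ w 1 (x + h) - φ w 1 x - L0 h‖) := by
      apply Tendsto.norm
      refine ((hconv _ (hb h hh)).sub (hconv x hx)).sub ?_
      exact ((ContinuousLinearMap.apply ℝ (Euc d) h).continuous.tendsto L0).comp hL0
    exact le_of_tendsto' t1 (fun n => hL3 n h hh)
  have hd := (hasFDerivAt_of_quad hr hq).fderiv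
  obtain ⟨-, -, -, -, hlow⟩ := flow_deriv hG hw (hB _ hw hRw) (hφ w hw) hr hb
  have hdet := det_ne_zero hr (Real.exp_pos _) hq hlow
  simp only [hL1, hd]
  exact (Real.continuousAt_log hdet).tendsto.comp
    ((ContinuousLinearMap.continuous_det.tendsto L0).comp hL0)

theorem sep_main (hG : GoodG Ω c G) {φ : (ℝ → V) → ℝ → Euc d → Euc d}
    (hφ : ∀ v, InV01 v → ∀ y ∈ Ω, IsPath Ω G v y (fun t => φ v t y))
    {H : Euc d → ℝ} (hH : ContinuousOn H Ω) (hHb : BddAbove (H '' Ω))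
    {n : ℕ} (hn : 0 < n) (X : Fin n → Euc d) (hX : ∀ k, X k ∈ Ω) {lam : ℝ} (hlam : 0 < lam) :
    ∃ w : ℝ → V, InV01 w ∧ ∀ v : ℝ → V, InV01 v →
      (1 / (n : ℝ)) * ∑ k, (Real.log ((fderiv ℝ (φ v 1) (X k)).det) + H (φ v 1 (X k)))
        - (lam / 2) * ∫ t in (0:ℝ)..1, ‖v t‖ ^ 2 ≤
      (1 / (n : ℝ)) * ∑ k, (Real.log ((fderiv ℝ (φ w 1) (X k)).det) + H (φ w 1 (X k)))
        - (lam / 2) * ∫ t in (0:ℝ)..1, ‖w t‖ ^ 2 := by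
  set Q : (ℝ → V) → ℝ := fun v =>
    (1 / (n : ℝ)) * ∑ k, (Real.log ((fderiv ℝ (φ v 1) (X k)).det) + H (φ v 1 (X k))) with hQ
  set I : (ℝ → V) → ℝ := fun v => ∫ t in (0:ℝ)..1, ‖v t‖ ^ 2 with hI
  change ∃ w : ℝ → V, InV01 w ∧ ∀ v : ℝ → V, InV01 v →
    Q v - (lam / 2) * I v ≤ Q w - (lam / 2) * I w
  obtain ⟨hm, hhm⟩ := hHb
  have hn' : (0:ℝ) < n := by exact_mod_cast hn
  have hc0 := hG.c0
  have hI0 : ∀ v, 0 ≤ I v := fun v => intervalIntegral.integral_nonneg zero_le_one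
    (fun u _ => by positivity)
  set η : ℝ := lam / (4 * (d * c + 1)) with hη
  have hη0 : 0 < η := by positivity
  have hη1 : d * c * η ≤ lam / 4 := by
    have : η * (4 * (d * c + 1)) = lam := by rw [hη]; field_simp
    nlinarith
  set C0 : ℝ := d * c * (1 / η) + hm with hC0
  have hup : ∀ v, InV01 v → Q v - (lam / 2) * I v ≤ C0 - (lam / 4) * I v := by
    intro v hv
    have hB := int1_bound hv (s := 0) (t := 1) le_rfl zero_le_one le_rfl hη0
    rw [sub_zero] at hB
    have h1 : ∀ k, Real.log ((fderiv ℝ (φ v 1) (X k)).det) + H (φ v 1 (X k)) ≤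
        d * c * (η * I v + 1 / η) + hm := by
      intro k
      apply add_le_add
      · exact (logdet_le hG hv (hφ v hv) (hX k)).trans
          (mul_le_mul_of_nonneg_left hB (by positivity))
      · exact hhm ⟨_, (hφ v hv (X k) (hX k)).mem 1 (by simp), rfl⟩
    have h2 : Q v ≤ d * c * (η * I v + 1 / η) + hm := by
      simp only [hQ]
      rw [one_div, inv_mul_le_iff₀ hn']
      calc _ ≤ ∑ k : Fin n, (d * c * (η * I v + 1 / η) + hm) := Finset.sum_le_sum (fun k _ => h1 k)
        _ = _ := by simp; ring
    have h3 := mul_le_mul_of_nonneg_right hη1 (hI0 v)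
    have h4 : d * c * (η * I v + 1 / η) = d * c * η * I v + d * c * (1 / η) := by ring
    linarith
  set A : Set ℝ := (fun v => Q v - (lam / 2) * I v) '' {v | InV01 v} with hA
  have hAb : BddAbove A := by
    refine ⟨C0, ?_⟩
    rintro _ ⟨v, hv, rfl⟩
    have := hup v hv
    have := mul_nonneg (show 0 ≤ lam / 4 by positivity) (hI0 v)
    simp only; linarith
  have hAne : A.Nonempty := by
    refine ⟨_, fun _ => 0, ⟨measurable_const, by simp⟩, rfl⟩
  have hseq : ∀ m : ℕ, ∃ v, InV01 v ∧ sSup A - 1 / ((m:ℝ) + 1) < Q v - (lam / 2) * I v := by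
    intro m
    obtain ⟨_, ⟨v, hv, rfl⟩, h⟩ := exists_lt_of_lt_csSup hAne
      (show sSup A - 1 / ((m:ℝ) + 1) < sSup A by
        have : 0 < 1 / ((m:ℝ) + 1) := by positivity
        linarith)
    exact ⟨v, hv, h⟩
  choose v hv hvs using hseq
  set R0 : ℝ := (C0 - sSup A + 1) * (4 / lam) with hR0
  have hR : ∀ m, I (v m) ≤ R0 := by
    intro m
    have h1 := hup _ (hv m)
    have h2 := hvs m
    have h3 : 1 / ((m:ℝ) + 1) ≤ 1 := by
      rw [div_le_one (by positivity)]; linarith [(Nat.cast_nonneg m : (0:ℝ) ≤ m)]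
    have h4 : lam / 4 * I (v m) ≤ C0 - sSup A + 1 := by linarith
    have h5 := mul_le_mul_of_nonneg_right h4 (show 0 ≤ 4 / lam by positivity)
    have h6 : lam / 4 * I (v m) * (4 / lam) = I (v m) := by field_simp
    linarith
  obtain ⟨w, hw, hlim, hlsc⟩ := weak_lim hG (hyperfilter ℕ) hv hR
  have hRw : I w ≤ R0 + 1 := by
    obtain ⟨m, hm⟩ := (hlsc 1 one_pos).exists
    have := hR m
    simp only [hI] at this ⊢
    linarith
  have hQt : Tendsto (fun m => Q (v m)) (hyperfilter ℕ) (𝓝 (Q w)) := by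
    apply Tendsto.const_mul
    apply tendsto_finsetSum
    intro k _
    exact term_conv hG (hyperfilter ℕ) hv hw (R := R0 + 1) (fun m => (hR m).trans (by linarith)) hRw
      hlim hφ (hX k) hH
  refine ⟨w, hw, fun z hz => ?_⟩
  have hzS : Q z - (lam / 2) * I z ≤ sSup A := le_csSup hAb ⟨z, hz, rfl⟩
  refine hzS.trans ?_
  apply le_of_forall_pos_le_add
  intro ε hε
  have hle : ((hyperfilter ℕ : Ultrafilter ℕ) : Filter ℕ) ≤ atTop := Nat.hyperfilter_le_atTop
  have t2 : Tendsto (fun m : ℕ => Q (v m) - lam / 2 * (I w - ε * (2 / lam)) + 1 / ((m:ℝ) + 1))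
      (hyperfilter ℕ) (𝓝 (Q w - lam / 2 * (I w - ε * (2 / lam)) + 0)) :=
    (hQt.sub_const _).add ((tendsto_one_div_add_atTop_nhds_zero_nat (𝕜 := ℝ)).mono_left hle)
  have h3 : sSup A ≤ Q w - lam / 2 * (I w - ε * (2 / lam)) + 0 := by
    apply ge_of_tendsto t2
    filter_upwards [hlsc (ε * (2 / lam)) (by positivity)] with m hm
    have h1 := hvs m
    have h2 : lam / 2 * (I w - ε * (2 / lam)) ≤ lam / 2 * I (v m) := by
      apply mul_le_mul_of_nonneg_left _ (by positivity)
      simp only [hI]; linarith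
    linarith
  have h4 : lam / 2 * (I w - ε * (2 / lam)) = lam / 2 * I w - ε := by field_simp
  linarith
end

lemma goodG_emb {d : ℕ} {Ω : Set (Euc d)} (hΩo : IsOpen Ω) (hΩb : Bornology.IsBounded Ω)
    {V : Type*} [NormedAddCommGroup V] [InnerProductSpace ℝ V]
    (ι : V →ₗ[ℝ] (Euc d → Euc d)) {c : ℝ} (hc : 0 < c)
    (hemb : ∀ f : V, MemC0k 2 Ω (ι f) ∧ CknormOn 2 Ω (ι f) ≤ c * ‖f‖) :
    GoodG Ω c (fun f : V => Ω.indicator (ι f)) := by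
  have key := fun f : V => ext_main (g := ι f) (M := c * ‖f‖) hΩo hΩb
    (by exact_mod_cast (hemb f).1.1) (hemb f).1.2 (by positivity) (by
      intro j hj
      refine le_trans ?_ (hemb f).2
      unfold CknormOn
      exact Finset.single_le_sum (f := fun j => ⨆ x ∈ Ω, ‖iteratedFDeriv ℝ j (ι f) x‖)
        (fun i _ => Real.iSup_nonneg (fun x => Real.iSup_nonneg (fun _ => norm_nonneg _)))
        (Finset.mem_range.2 (by omega)))
  refine ⟨hc.le, hΩo, ?_, ?_, ?_, ?_, ?_, ?_⟩
  · intro f g y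
    by_cases hy : y ∈ Ω <;> simp [hy]
  · intro r f y
    by_cases hy : y ∈ Ω <;> simp [hy]
  · intro f y hy
    simp [hy]
  · exact fun f y => (key f).1 y
  · exact fun f y z => (key f).2.1 y z
  · intro f y
    obtain ⟨D, h1, h2⟩ := (key f).2.2
    exact ⟨D y, h1 y, h2 y⟩

lemma exists_sep {d : ℕ} {Ω : Set (Euc d)} {V : Type*} [NormedAddCommGroup V]
    [InnerProductSpace ℝ V] [CompleteSpace V] {c : ℝ} {G : V → Euc d → Euc d}
    (hG : GoodG Ω c G) : ∃ W : Submodule ℝ V, IsClosed (W : Set V) ∧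
      TopologicalSpace.IsSeparable (W : Set V) ∧ ∀ f ∈ Wᗮ, ∀ y, G f y = 0 := by
  let L : Euc d → Fin d → V →L[ℝ] ℝ := fun y i =>
    LinearMap.mkContinuous
      { toFun := fun f => G f y i
        map_add' := fun f g => by rw [hG.add]; rfl
        map_smul' := fun r f => by rw [hG.smul]; rfl } c
      (fun f => (PiLp.norm_apply_le (G f y) i).trans (hG.b0 f y))
  let q : ℕ → Euc d := TopologicalSpace.denseSeq (Euc d)
  let r : ℕ × Fin d → V := fun p => (InnerProductSpace.toDual ℝ V).symm (L (q p.1) p.2)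
  refine ⟨(Submodule.span ℝ (range r)).topologicalClosure,
    Submodule.isClosed_topologicalClosure _, ?_, ?_⟩
  · rw [Submodule.topologicalClosure_coe]
    exact ((countable_range r).isSeparable.span (R := ℝ)).closure
  · intro f hf
    have h0 : ∀ m, G f (q m) = 0 := by
      intro m
      ext i
      have h1 : r (m, i) ∈ (Submodule.span ℝ (range r)).topologicalClosure :=
        Submodule.le_topologicalClosure _ (Submodule.subset_span ⟨_, rfl⟩)
      have h2 := (Submodule.mem_orthogonal _ _).1 hf _ h1
      have h3 : inner ℝ (r (m, i)) f = L (q m) i f := InnerProductSpace.toDual_symm_apply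
      rw [h3] at h2
      exact h2
    have hcont : Continuous (G f) :=
      hG.cont.comp (continuous_const.prodMk continuous_id)
    have := (TopologicalSpace.denseRange_denseSeq (Euc d)).equalizer hcont
      (continuous_const (y := (0 : Euc d))) (funext h0)
    intro y
    exact congrFun this y

/-- existence of the penalized maximum likelihood estimate. With
`V ↪ C_0^2(Ω,ℝ^d)`, `Ω` bounded open, and `e^H` a bounded continuous probability density
on `Ω`, for any data `X_1,…,X_n ∈ Ω` and `λ > 0` there is `v̂ ∈ V^{[0,1]}` attaining
`sup_{v ∈ V^{[0,1]}} E_λ(v)`. -/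
theorem stmt_2 {d : ℕ} (Ω : Set (Euc d)) (hΩo : IsOpen Ω) (hΩb : Bornology.IsBounded Ω)
    (V : Type*) [NormedAddCommGroup V] [InnerProductSpace ℝ V] [CompleteSpace V]
    [MeasurableSpace V] [BorelSpace V]
    (ι : V →ₗ[ℝ] (Euc d → Euc d)) (hinj : Function.Injective ι)
    (c : ℝ) (hc : 0 < c)
    (hemb : ∀ f : V, MemC0k 2 Ω (ι f) ∧ CknormOn 2 Ω (ι f) ≤ c * ‖f‖)
    (H : Euc d → ℝ) (hHc : ContinuousOn (fun x => Real.exp (H x)) Ω)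
    (hHb : BddAbove (H '' Ω)) (hHd : ∫ x in Ω, Real.exp (H x) = 1)
    (n : ℕ) (hn : 0 < n) (X : Fin n → Euc d) (hX : ∀ k, X k ∈ Ω)
    (lam : ℝ) (hlam : 0 < lam)
    (Φ : (ℝ → V) → ℝ → ℝ → Euc d → Euc d)
    (hflow : ∀ v : ℝ → V, InV01 v → ∀ s ∈ Icc (0:ℝ) 1, ∀ t ∈ Icc (0:ℝ) 1, ∀ x ∈ Ω,
      Φ v s t x = x + ∫ u in s..t, ι (v u) (Φ v s u x)) :
    ∃ vhat : ℝ → V, InV01 vhat ∧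
      ∀ v : ℝ → V, InV01 v → Elam ι Φ H X lam v ≤ Elam ι Φ H X lam vhat := by
  have hGV := goodG_emb hΩo hΩb ι hc hemb
  obtain ⟨W, hWc, hWs, hW0⟩ := exists_sep hGV
  have : CompleteSpace W := hWc.completeSpace_coe
  have : TopologicalSpace.SeparableSpace W := hWs.separableSpace
  have : SecondCountableTopology W := UniformSpace.secondCountable_of_separable W
  have : BorelSpace W := Subtype.borelSpace _
  have hGW : GoodG Ω c (fun f : W => Ω.indicator (ι (f : V))) :=
    goodG_emb hΩo hΩb (ι.comp W.subtype) hc (fun f => hemb f)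
  have hH : ContinuousOn H Ω := by
    have := hHc.log (fun x _ => (Real.exp_pos _).ne')
    simpa using this
  have hcoe : ∀ w : ℝ → W, InV01 w → InV01 (fun u => (w u : V)) := fun w hw =>
    ⟨measurable_subtype_coe.comp hw.1, hw.2⟩
  have hφ : ∀ w : ℝ → W, InV01 w → ∀ y ∈ Ω, IsPath Ω (fun f : W => Ω.indicator (ι (f : V))) w y
      (fun t => Φ (fun u => (w u : V)) 0 t y) := by
    intro w hw y hy
    exact path_of_flow hGW hw hy (k := fun u => ι (w u : V))
      (fun u z hz => (indicator_of_mem hz _).symm)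
      (fun t ht => hflow _ (hcoe w hw) 0 (by simp) t ht y hy)
  obtain ⟨w, hw, hmax⟩ := sep_main hGW (φ := fun w t y => Φ (fun u => (w u : V)) 0 t y)
    hφ hH hHb hn X hX hlam
  refine ⟨fun u => (w u : V), hcoe w hw, fun v hv => ?_⟩
  let P := W.orthogonalProjectionOnto
  have hPn : ∀ f, ‖P f‖ ≤ ‖f‖ := fun f => Submodule.norm_orthogonalProjectionOnto_apply_le W f
  let z : ℝ → W := fun u => P (v u)
  have hzm : Measurable z := P.continuous.measurable.comp hv.1
  have hz : InV01 z := by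
    refine ⟨hzm, Integrable.mono' hv.2 (hzm.norm.pow_const 2).aestronglyMeasurable ?_⟩
    filter_upwards with u
    rw [Real.norm_of_nonneg (by positivity)]
    exact pow_le_pow_left₀ (norm_nonneg _) (hPn _) 2
  have hι : ∀ u, ∀ y ∈ Ω, ι (v u) y = ι (z u : V) y := by
    intro u y hy
    have h1 : v u - (z u : V) ∈ Wᗮ := Submodule.sub_starProjection_mem_orthogonal (v u)
    have h2 := hW0 _ h1 y
    simp only [indicator_of_mem hy, map_sub, Pi.sub_apply] at h2
    exact sub_eq_zero.1 h2
  have heq : ∀ y ∈ Ω, Φ v 0 1 y = Φ (fun u => (z u : V)) 0 1 y := by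
    intro y hy
    have p1 : IsPath Ω (fun f : W => Ω.indicator (ι (f : V))) z y (fun t => Φ v 0 t y) :=
      path_of_flow hGW hz hy (k := fun u => ι (v u))
        (fun u x hx => by simp only [indicator_of_mem hx]; exact hι u x hx)
        (fun t ht => hflow _ hv 0 (by simp) t ht y hy)
    have := (path_lip hGW hz le_rfl p1 (hφ z hz y hy)).1 1 (by simp)
    rw [sub_self, norm_zero, zero_mul] at this
    exact sub_eq_zero.1 (norm_le_zero_iff.1 this)
  refine le_trans ?_ (hmax z hz)
  unfold Elam
  have hs : ∀ k, Real.log ((fderiv ℝ (Φ v 0 1) (X k)).det) + H (Φ v 0 1 (X k)) =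
      Real.log ((fderiv ℝ (Φ (fun u => (z u : V)) 0 1) (X k)).det) +
        H (Φ (fun u => (z u : V)) 0 1 (X k)) := by
    intro k
    have : Φ v 0 1 =ᶠ[𝓝 (X k)] Φ (fun u => (z u : V)) 0 1 := by
      filter_upwards [hΩo.mem_nhds (hX k)] with y hy using heq y hy
    rw [this.fderiv_eq, heq _ (hX k)]
  simp only [hs]
  have hint : ∫ t in (0:ℝ)..1, ‖z t‖ ^ 2 ≤ ∫ t in (0:ℝ)..1, ‖v t‖ ^ 2 := by
    apply intervalIntegral.integral_mono_on zero_le_one (int1 hz (by simp) (by simp)).2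
      (int1 hv (by simp) (by simp)).2
    intro u _
    exact pow_le_pow_left₀ (norm_nonneg _) (hPn _) 2
  have := mul_le_mul_of_nonneg_left hint (show 0 ≤ lam / 2 by positivity)
  linarith
end
end

section
/- Let Ω be an open bounded subset of ℝ^d and V a Hilbert space continuously embedded in C_0^1(Ω,ℝ^d) with embedding constant c. Then for all v, w ∈ V^{[0,1]} and all s,t ∈ [0,1], the flows satisfy ‖φ^v_{st} − φ^w_{st}‖_∞ ≤ c ‖v − w‖_{V^{[0,1]}} exp( c ‖v‖_{V^{[0,1]}} ), where ‖·‖_∞ is the supremum norm over Ω and the constant c does not depend on v, w, s or t. -/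
open MeasureTheory Set Filter
open scoped RealInnerProductSpace BigOperators Topology

noncomputable section

lemma aux_sec_meas {V : Type*} [MetricSpace V] [MeasurableSpace V] [BorelSpace V]
    (f : ℝ → V) (hf : Measurable f) (ε : ℝ) (hε : 0 < ε) (A : Set V) (g : V → ℝ)
    (hg : ∀ e ∈ A, f (g e) = e) (hA : A.Pairwise (fun a b => ε ≤ dist a b)) :
    MeasurableSet (g '' A) := by
  classical
  have huniq : ∀ x, ∀ a ∈ A, ∀ b ∈ A, dist x a < ε / 2 → dist x b < ε / 2 → a = b := by
    intro x a ha b hb h1 h2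
    by_contra hne
    have := hA ha hb hne
    have h3 := dist_triangle_left a b x
    linarith
  let k : ℝ → ℝ := fun x => if h : ∃ e ∈ A, dist (f x) e < ε / 2 then g h.choose else x + 1
  have hk1 : ∀ x, ∀ e ∈ A, dist (f x) e < ε / 2 → k x = g e := by
    intro x e he hd
    have h : ∃ e ∈ A, dist (f x) e < ε / 2 := ⟨e, he, hd⟩
    simp only [k, dif_pos h]
    rw [huniq (f x) _ h.choose_spec.1 e he h.choose_spec.2 hd]
  have hk2 : ∀ x, (¬ ∃ e ∈ A, dist (f x) e < ε / 2) → k x = x + 1 := by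
    intro x h
    simp only [k, dif_neg h]
  have hU : ∀ B : Set V, MeasurableSet {x | ∃ e ∈ B, dist (f x) e < ε / 2} := by
    intro B
    have : {x | ∃ e ∈ B, dist (f x) e < ε / 2} = f ⁻¹' (⋃ e ∈ B, Metric.ball e (ε / 2)) := by
      ext x; simp
    rw [this]
    exact hf (isOpen_biUnion fun _ _ => Metric.isOpen_ball).measurableSet
  have hkm : Measurable k := by
    intro B hB
    have : k ⁻¹' B = {x | ∃ e ∈ (A ∩ g ⁻¹' B), dist (f x) e < ε / 2} ∪
        ({x | ∃ e ∈ A, dist (f x) e < ε / 2}ᶜ ∩ (fun x => x + 1) ⁻¹' B) := by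
      ext x
      by_cases h : ∃ e ∈ A, dist (f x) e < ε / 2
      · obtain ⟨e, he, hd⟩ := h
        simp only [mem_preimage, hk1 x e he hd, mem_union, mem_inter_iff]
        constructor
        · intro hB
          exact Or.inl ⟨e, ⟨he, hB⟩, hd⟩
        · rintro (⟨e', ⟨he', hB'⟩, hd'⟩ | ⟨h1, _⟩)
          · rwa [huniq (f x) e he e' he' hd hd']
          · exact absurd ⟨e, he, hd⟩ h1
      · simp only [mem_preimage, hk2 x h, mem_union, mem_inter_iff]
        constructor
        · intro hB
          exact Or.inr ⟨h, hB⟩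
        · rintro (⟨e', ⟨he', hB'⟩, hd'⟩ | ⟨_, h1⟩)
          · exact absurd ⟨e', he', hd'⟩ h
          · exact h1
    rw [this]
    exact (hU _).union ((hU _).compl.inter ((measurable_id.add_const (1:ℝ)) hB))
  have : g '' A = {x | k x = x} := by
    ext x
    constructor
    · rintro ⟨e, he, rfl⟩
      exact hk1 _ e he (by rw [hg e he, dist_self]; positivity)
    · intro hx
      by_cases h : ∃ e ∈ A, dist (f x) e < ε / 2
      · obtain ⟨e, he, hd⟩ := h
        exact ⟨e, he, by rw [← hk1 x e he hd]; exact hx⟩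
      · have h1 := hk2 x h
        have h2 : k x = x := hx
        linarith
  rw [this]
  exact measurableSet_eq_fun hkm measurable_id

lemma aux_all_meas_countable (S : Set ℝ) (hS : ∀ A ⊆ S, MeasurableSet A) : S.Countable := by
  by_contra hc
  have hSm := hS S subset_rfl
  have : StandardBorelSpace S := hSm.standardBorel
  have hnc : ¬ Countable S := hc
  have e : S ≃ᵐ ℝ := PolishSpace.measurableEquivOfNotCountable hnc
    (fun h => Cardinal.not_countable_real (Set.countable_univ_iff.2 h))
  have hcard : Cardinal.mk S = Cardinal.continuum := by
    rw [Cardinal.mk_congr e.toEquiv, Cardinal.mk_real]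
  have hle : Cardinal.mk {t : Set ℝ | MeasurableSet t} ≤ Cardinal.continuum := by
    have h1 : (inferInstance : MeasurableSpace ℝ) =
        MeasurableSpace.generateFrom (TopologicalSpace.countableBasis ℝ) := by
      rw [(inferInstance : BorelSpace ℝ).measurable_eq]
      exact (TopologicalSpace.isBasis_countableBasis ℝ).borel_eq_generateFrom
    have h2 := MeasurableSpace.cardinal_measurableSet_le_continuum
      (s := TopologicalSpace.countableBasis ℝ)
      (((TopologicalSpace.countable_countableBasis ℝ).le_aleph0).trans
        Cardinal.aleph0_le_continuum)
    rw [← h1] at h2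
    exact h2
  have hinj : Cardinal.mk (Set S) ≤ Cardinal.mk {t : Set ℝ | MeasurableSet t} := by
    refine Cardinal.mk_le_of_injective (f := fun A : Set S =>
      (⟨Subtype.val '' A, hS _ (by simp)⟩ : {t : Set ℝ | MeasurableSet t})) ?_
    intro A B h
    have : Subtype.val '' A = Subtype.val '' B := congrArg Subtype.val h
    exact Subtype.val_injective.image_injective this
  rw [Cardinal.mk_set, hcard] at hinj
  exact absurd (hinj.trans hle) (not_le.2 (Cardinal.cantor _))

lemma aux_sep_countable {V : Type*} [MetricSpace V] [MeasurableSpace V] [BorelSpace V]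
    (f : ℝ → V) (hf : Measurable f) (ε : ℝ) (hε : 0 < ε) (A : Set V) (hAr : A ⊆ range f)
    (hA : A.Pairwise (fun a b => ε ≤ dist a b)) : A.Countable := by
  have : ∀ e : V, ∃ x : ℝ, e ∈ A → f x = e := by
    intro e
    by_cases h : e ∈ A
    · obtain ⟨x, hx⟩ := hAr h
      exact ⟨x, fun _ => hx⟩
    · exact ⟨0, fun h' => absurd h' h⟩
  choose g hg using this
  have hinj : InjOn g A := by
    intro a ha b hb h
    rw [← hg a ha, ← hg b hb, h]
  have hc : (g '' A).Countable := by
    apply aux_all_meas_countable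
    intro B hB
    obtain ⟨A', hA', rfl⟩ := subset_image_iff.1 hB
    exact aux_sec_meas f hf ε hε A' g (fun e he => hg e (hA' he)) (hA.mono hA')
  exact (Set.countable_of_injective_of_countable_image hinj hc)

lemma aux_stronglyMeasurable {V : Type*} [MetricSpace V] [MeasurableSpace V] [BorelSpace V]
    (f : ℝ → V) (hf : Measurable f) : StronglyMeasurable f := by
  rw [stronglyMeasurable_iff_measurable_separable]
  refine ⟨hf, ?_⟩
  have : ∀ n : ℕ, ∃ E : Set V, E.Countable ∧ ∀ y ∈ range f, ∃ e ∈ E, dist y e < 1 / ((n:ℝ) + 1) := by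
    intro n
    have hε : (0:ℝ) < 1 / ((n:ℝ) + 1) := by positivity
    set ε := 1 / ((n:ℝ) + 1)
    obtain ⟨M, hM⟩ := zorn_subset
      {E : Set V | E ⊆ range f ∧ E.Pairwise (fun a b => ε ≤ dist a b)} (by
        intro c hc hch
        refine ⟨⋃₀ c, ⟨sUnion_subset fun s hs => (hc hs).1, ?_⟩, fun s hs => subset_sUnion_of_mem hs⟩
        exact (pairwise_sUnion hch.directedOn).2 fun s hs => (hc hs).2)
    refine ⟨M, aux_sep_countable f hf ε hε M hM.prop.1 hM.prop.2, ?_⟩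
    intro y hy
    by_contra! hcon
    have hins : insert y M ⊆ M := by
      apply hM.le_of_ge _ (subset_insert y M)
      refine ⟨insert_subset hy hM.prop.1, ?_⟩
      intro a ha b hb hab
      rcases ha with rfl | ha <;> rcases hb with rfl | hb
      · exact absurd rfl hab
      · exact hcon b hb
      · rw [dist_comm]; exact hcon a ha
      · exact hM.prop.2 ha hb hab
    have := hcon y (hins (mem_insert y M))
    rw [dist_self] at this
    linarith
  choose E hE hE2 using this
  refine ⟨⋃ n, E n, countable_iUnion hE, ?_⟩
  intro y hy
  rw [Metric.mem_closure_iff]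
  intro ε hε
  obtain ⟨n, hn⟩ := exists_nat_one_div_lt hε
  obtain ⟨e, he, hd⟩ := hE2 n y hy
  exact ⟨e, mem_iUnion.2 ⟨n, he⟩, hd.trans hn⟩

lemma aux_gronwall (s T C : ℝ) (hsT : s ≤ T) (a y : ℝ → ℝ) (ha0 : ∀ u, 0 ≤ a u)
    (ha : IntervalIntegrable a volume s T) (hy : ContinuousOn y (Icc s T))
    (h : ∀ t ∈ Icc s T, y t ≤ C + ∫ u in s..t, a u * y u) :
    y T ≤ C * Real.exp (∫ u in s..T, a u) := by
  have huI : uIcc s T = Icc s T := uIcc_of_le hsT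
  have hay : IntervalIntegrable (fun u => a u * y u) volume s T :=
    ha.mul_continuousOn (by rwa [huI])
  set A : ℝ → ℝ := fun t => ∫ u in s..t, a u with hA
  set z : ℝ → ℝ := fun t => ∫ u in s..t, a u * y u with hz
  have hAac : AbsolutelyContinuousOnInterval A s T :=
    ha.absolutelyContinuousOnInterval_intervalIntegral left_mem_uIcc
  have hzac : AbsolutelyContinuousOnInterval z s T :=
    hay.absolutelyContinuousOnInterval_intervalIntegral left_mem_uIcc
  have hcac : AbsolutelyContinuousOnInterval (fun _ : ℝ => C) s T :=
    ((LipschitzWith.const C).lipschitzOnWith (s := uIcc s T)).absolutelyContinuousOnInterval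
  have hA0 : ∀ t ∈ Icc s T, 0 ≤ A t := fun t ht =>
    intervalIntegral.integral_nonneg ht.1 fun u _ => ha0 u
  have hexp : ∀ p q : ℝ, 0 ≤ p → 0 ≤ q → |Real.exp (-p) - Real.exp (-q)| ≤ |p - q| := by
    have key : ∀ p q : ℝ, 0 ≤ p → p ≤ q → |Real.exp (-p) - Real.exp (-q)| ≤ |p - q| := by
      intro p q hp hpq
      have h1 : Real.exp (-q) ≤ Real.exp (-p) := Real.exp_le_exp.2 (by linarith)
      rw [abs_of_nonneg (by linarith), abs_of_nonpos (by linarith)]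
      have h2 : Real.exp (-q) = Real.exp (-p) * Real.exp (p - q) := by
        rw [← Real.exp_add]; ring_nf
      have h3 := Real.add_one_le_exp (p - q)
      have h4 : Real.exp (-p) ≤ 1 := Real.exp_le_one_iff.2 (by linarith)
      have h5 := Real.exp_pos (-p)
      rw [h2]
      nlinarith
    intro p q hp hq
    rcases le_total p q with hpq | hpq
    · exact key p q hp hpq
    · rw [abs_sub_comm, abs_sub_comm p q]; exact key q p hq hpq
  set g : ℝ → ℝ := fun t => Real.exp (-A t) with hgdef
  have hgac : AbsolutelyContinuousOnInterval g s T := by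
    rw [absolutelyContinuousOnInterval_iff] at hAac ⊢
    intro ε hε
    obtain ⟨δ, hδ, hh⟩ := hAac ε hε
    refine ⟨δ, hδ, fun E hE hlt => lt_of_le_of_lt (Finset.sum_le_sum fun i hi => ?_) (hh E hE hlt)⟩
    have := hE.1 i hi
    rw [huI] at this
    rw [Real.dist_eq, Real.dist_eq]
    exact hexp _ _ (hA0 _ this.1) (hA0 _ this.2)
  have hzc := hcac.add hzac
  have key := AbsolutelyContinuousOnInterval.integral_deriv_mul_eq_sub hzc hgac
  have hle : ∫ x in s..T, deriv ((fun _ : ℝ => C) + z) x * g x + ((fun _ : ℝ => C) + z) x * deriv g x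
      ≤ 0 := by
    rw [intervalIntegral.integral_of_le hsT]
    apply integral_nonpos_of_ae
    rw [EventuallyLE, ae_restrict_iff' measurableSet_Ioc]
    filter_upwards [ha.ae_hasDerivAt_integral, hay.ae_hasDerivAt_integral] with x h1 h2 hx
    have hx' : x ∈ uIcc s T := by rw [huI]; exact Ioc_subset_Icc_self hx
    have d1 : HasDerivAt A (a x) x := h1 hx' s left_mem_uIcc
    have d2 : HasDerivAt z (a x * y x) x := h2 hx' s left_mem_uIcc
    have d3 : HasDerivAt g (Real.exp (-A x) * (-a x)) x := d1.neg.exp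
    have d4 : HasDerivAt ((fun _ : ℝ => C) + z) (a x * y x) x := by
      simpa using (hasDerivAt_const x C).add d2
    rw [d3.deriv, d4.deriv]
    have hy' := h x (Ioc_subset_Icc_self hx)
    simp only [Pi.add_apply, Pi.zero_apply]
    have : a x * y x * g x + (C + z x) * (Real.exp (-A x) * (-a x))
      = (a x * Real.exp (-A x)) * (y x - (C + z x)) := by simp only [hgdef]; ring
    rw [this]
    apply mul_nonpos_of_nonneg_of_nonpos
    · exact mul_nonneg (ha0 x) (Real.exp_pos _).le
    · simp only [hz]; linarith
  rw [key] at hle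
  have hzs : z s = 0 := by simp [hz]
  have hAs : A s = 0 := by simp [hA]
  simp only [Pi.add_apply, hzs, hgdef, hAs, neg_zero, Real.exp_zero, add_zero, mul_one] at hle
  have hyT := h T (right_mem_Icc.2 hsT)
  have e1 : (C + z T) * Real.exp (-A T) * Real.exp (A T) = C + z T := by
    rw [mul_assoc, ← Real.exp_add]; simp
  have : (C + z T) * Real.exp (-A T) * Real.exp (A T) ≤ C * Real.exp (A T) :=
    mul_le_mul_of_nonneg_right (by linarith) (Real.exp_pos _).le
  rw [e1] at this
  exact hyT.trans this

lemma aux_gronwall_back (s T : ℝ) (hsT : s ≤ T) (a y : ℝ → ℝ) (ha0 : ∀ u, 0 ≤ a u)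
    (ha : IntervalIntegrable a volume s T) (hy : ContinuousOn y (Icc s T))
    (h : ∀ t ∈ Icc s T, y t ≤ ∫ u in t..T, a u * y u) :
    y s ≤ 0 := by
  have := aux_gronwall (-T) (-s) 0 (by linarith) (fun u => a (-u)) (fun u => y (-u))
    (fun u => ha0 _) ((IntervalIntegrable.iff_comp_neg).1 ha.symm)
    (hy.comp continuousOn_neg (fun u hu => ⟨by linarith [hu.2], by linarith [hu.1]⟩))
    (by
      intro t ht
      have h1 := h (-t) ⟨by linarith [ht.2], by linarith [ht.1]⟩
      rw [intervalIntegral.integral_comp_neg (fun u => a u * y u)]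
      simpa using h1)
  simpa using this

structure FieldOK {d : ℕ} (Ω : Set (Euc d)) (F : ℝ → Euc d → Euc d) (a : ℝ → ℝ) : Prop where
  nonneg : ∀ u, 0 ≤ a u
  bdd : ∀ u, ∀ y ∈ Ω, ‖F u y‖ ≤ a u
  lip : ∀ u y z, ‖indicator Ω (F u) y - indicator Ω (F u) z‖ ≤ a u * ‖y - z‖
  meas : ∀ y ∈ Ω, Measurable (fun u => F u y)

lemma aux_int_meas {d : ℕ} (s T : ℝ) (h : ℝ → Euc d) :
    AEMeasurable (fun t => ∫ u in s..t, h u) (volume.restrict (Icc s T)) := by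
  classical
  set D : Set ℝ := {t | s ≤ t ∧ IntervalIntegrable h volume s t} with hD
  have hsub : ∀ t ∈ D, ∀ r ∈ Icc s t, r ∈ D := by
    intro t ht r hr
    refine ⟨hr.1, ht.2.mono_set ?_⟩
    rw [uIcc_of_le hr.1, uIcc_of_le ht.1]
    exact Icc_subset_Icc_right hr.2
  have hDm : MeasurableSet D := by
    apply OrdConnected.measurableSet
    refine ⟨fun x hx y hy z hz => hsub y hy z ⟨hx.1.trans hz.1, hz.2⟩⟩
  have hcont : ContinuousOn (fun t => ∫ u in s..t, h u) D := by
    have hc : ∀ t ∈ D, ContinuousOn (fun t => ∫ u in s..t, h u) (Icc s t) := by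
      intro t ht
      have := intervalIntegral.continuousOn_primitive_interval (f := h) (μ := volume) (a := s) (b := t)
        (by rw [uIcc_of_le ht.1]; exact (intervalIntegrable_iff_integrableOn_Icc_of_le ht.1).1 ht.2)
      rwa [uIcc_of_le ht.1] at this
    intro t ht
    by_cases hex : ∃ r ∈ D, t < r
    · obtain ⟨r, hr, htr⟩ := hex
      have h1 := hc r hr t ⟨ht.1, htr.le⟩
      apply h1.mono_of_mem_nhdsWithin
      filter_upwards [self_mem_nhdsWithin, mem_nhdsWithin_of_mem_nhds (Iio_mem_nhds htr)] with u hu hu2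
      exact ⟨hu.1, le_of_lt hu2⟩
    · push Not at hex
      exact (hc t ht t ⟨ht.1, le_rfl⟩).mono fun u hu => ⟨hu.1, hex u hu⟩
  have h1 : AEMeasurable (fun t => ∫ u in s..t, h u) (volume.restrict D) :=
    hcont.aemeasurable hDm
  have h2 : AEMeasurable (D.indicator fun t => ∫ u in s..t, h u) volume :=
    (aemeasurable_indicator_iff hDm).2 h1
  refine (h2.restrict (s := Icc s T)).congr ?_
  rw [EventuallyEq, ae_restrict_iff' measurableSet_Icc]
  refine Eventually.of_forall fun t ht => ?_
  by_cases htD : t ∈ D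
  · simp [htD]
  · rw [indicator_of_notMem htD]
    have : ¬ IntervalIntegrable h volume s t := fun hh => htD ⟨ht.1, hh⟩
    exact (intervalIntegral.integral_undef this).symm

lemma FieldOK.comp_meas {d : ℕ} {Ω : Set (Euc d)} {F : ℝ → Euc d → Euc d} {a : ℝ → ℝ}
    (H : FieldOK Ω F a) {μ : Measure ℝ} {p : ℝ → Euc d} (hp : AEMeasurable p μ) :
    AEMeasurable (fun u => indicator Ω (F u) (p u)) μ := by
  have hj : StronglyMeasurable (Function.uncurry fun (y : Euc d) (u : ℝ) => indicator Ω (F u) y) := by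
    apply stronglyMeasurable_uncurry_of_continuous_of_stronglyMeasurable
    · intro u
      have : LipschitzWith (a u).toNNReal (indicator Ω (F u)) := by
        apply LipschitzWith.of_dist_le_mul
        intro y z
        rw [dist_eq_norm, dist_eq_norm, Real.coe_toNNReal _ (H.nonneg u)]
        exact H.lip u y z
      exact this.continuous
    · intro y
      by_cases hy : y ∈ Ω
      · simpa [indicator_of_mem hy] using (H.meas y hy).stronglyMeasurable
      · simpa [indicator_of_notMem hy] using stronglyMeasurable_const
  exact hj.measurable.comp_aemeasurable (hp.prodMk aemeasurable_id)

lemma aux_stay {d : ℕ} {Ω : Set (Euc d)} (hΩ : IsOpen Ω) {F : ℝ → Euc d → Euc d} {a : ℝ → ℝ}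
    (H : FieldOK Ω F a) {s T : ℝ} (hsT : s ≤ T) (ha : IntervalIntegrable a volume s T)
    {p : ℝ → Euc d} {x : Euc d} (hx : x ∈ Ω)
    (hp : ∀ t ∈ Icc s T, p t = x + ∫ u in s..t, F u (p u)) :
    (∀ t ∈ Icc s T, p t ∈ Ω) ∧ IntervalIntegrable (fun u => F u (p u)) volume s T ∧
      ContinuousOn p (Icc s T) := by
  have hpm : AEMeasurable p (volume.restrict (Icc s T)) := by
    refine ((aux_int_meas s T (fun u => F u (p u))).const_add x).congr ?_
    rw [EventuallyEq, ae_restrict_iff' measurableSet_Icc]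
    exact Eventually.of_forall fun t ht => (hp t ht).symm
  have hint : ∀ τ ∈ Icc s T, (∀ u ∈ Ico s τ, p u ∈ Ω) →
      IntervalIntegrable (fun u => F u (p u)) volume s τ := by
    intro τ hτ hin
    rw [intervalIntegrable_iff_integrableOn_Ico_of_le hτ.1]
    have haI : IntegrableOn a (Ico s τ) := by
      have := (intervalIntegrable_iff_integrableOn_Ico_of_le hsT).1 ha
      exact this.mono_set (Ico_subset_Ico_right hτ.2)
    refine Integrable.mono' haI ?_ ?_
    · have h1 : AEMeasurable p (volume.restrict (Ico s τ)) :=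
        hpm.mono_measure (Measure.restrict_mono
          (Ico_subset_Icc_self.trans (Icc_subset_Icc_right hτ.2)) le_rfl)
      refine ((H.comp_meas h1).congr ?_).aestronglyMeasurable
      rw [EventuallyEq, ae_restrict_iff' measurableSet_Ico]
      exact Eventually.of_forall fun t ht => indicator_of_mem (hin t ht) _
    · rw [ae_restrict_iff' measurableSet_Ico]
      exact Eventually.of_forall fun t ht => H.bdd t _ (hin t ht)
  have hcont : ∀ τ ∈ Icc s T, IntervalIntegrable (fun u => F u (p u)) volume s τ →
      ContinuousOn p (Icc s τ) := by
    intro τ hτ hi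
    have := intervalIntegral.continuousOn_primitive_interval (f := fun u => F u (p u))
        (μ := volume) (a := s) (b := τ)
        (by rw [uIcc_of_le hτ.1]; exact (intervalIntegrable_iff_integrableOn_Icc_of_le hτ.1).1 hi)
    rw [uIcc_of_le hτ.1] at this
    exact (this.const_add x).congr fun t ht => hp t ⟨ht.1, ht.2.trans hτ.2⟩
  -- points of closure stay inside
  have hclosed : ∀ τ ∈ Icc s T, (∀ u ∈ Ico s τ, p u ∈ Ω) → p τ ∈ Ω := by
    intro τ hτ hin
    by_contra hout
    have hi := hint τ hτ hin
    have hc := hcont τ hτ hi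
    have hiv : ∀ t ∈ Icc s τ, IntervalIntegrable (fun u => F u (p u)) volume s t ∧
        IntervalIntegrable (fun u => F u (p u)) volume t τ := by
      intro t ht
      constructor
      · apply hi.mono_set; rw [uIcc_of_le ht.1, uIcc_of_le hτ.1]; exact Icc_subset_Icc_right ht.2
      · apply hi.mono_set; rw [uIcc_of_le ht.2, uIcc_of_le hτ.1]; exact Icc_subset_Icc_left ht.1
    have haτ : IntervalIntegrable a volume s τ := by
      apply ha.mono_set; rw [uIcc_of_le hsT, uIcc_of_le hτ.1]; exact Icc_subset_Icc_right hτ.2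
    have hyc : ContinuousOn (fun t => ‖p τ - p t‖) (Icc s τ) :=
      (continuousOn_const.sub hc).norm
    have hg := aux_gronwall_back s τ hτ.1 a (fun t => ‖p τ - p t‖) H.nonneg haτ hyc (by
      intro t ht
      have e1 : p τ - p t = ∫ u in t..τ, F u (p u) := by
        rw [hp τ hτ, hp t ⟨ht.1, ht.2.trans hτ.2⟩, add_sub_add_left_eq_sub,
          intervalIntegral.integral_interval_sub_left hi (hiv t ht).1]
      show ‖p τ - p t‖ ≤ _
      rw [e1]
      apply intervalIntegral.norm_integral_le_of_norm_le ht.2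
      · have hne : ∀ᵐ u : ℝ, u ≠ τ := by
          simp [ae_iff, measure_singleton]
        filter_upwards [hne] with u hu hut
        have huΩ : p u ∈ Ω := hin u ⟨ht.1.trans hut.1.le, lt_of_le_of_ne hut.2 hu⟩
        have := H.lip u (p u) (p τ)
        rw [indicator_of_mem huΩ, indicator_of_notMem hout, sub_zero, norm_sub_rev] at this
        exact this
      · apply IntervalIntegrable.mul_continuousOn
        · apply haτ.mono_set; rw [uIcc_of_le ht.2, uIcc_of_le hτ.1]; exact Icc_subset_Icc_left ht.1
        · rw [uIcc_of_le ht.2]; exact hyc.mono (Icc_subset_Icc_left ht.1))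
    have h0 : p τ = p s := by
      have := le_antisymm hg (norm_nonneg _)
      exact sub_eq_zero.1 (norm_eq_zero.1 this)
    have hps : p s = x := by rw [hp s ⟨le_rfl, hsT⟩]; simp
    rw [h0, hps] at hout
    exact hout hx
  have hall : ∀ t ∈ Icc s T, p t ∈ Ω := by
    by_contra! hcon
    set B : Set ℝ := {t | t ∈ Icc s T ∧ p t ∉ Ω} with hB
    have hBne : B.Nonempty := by
      obtain ⟨t, ht, h1⟩ := hcon; exact ⟨t, ht, h1⟩
    have hBb : BddBelow B := ⟨s, fun t ht => ht.1.1⟩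
    set τ := sInf B with hτ
    obtain ⟨t₁, ht₁⟩ := hBne
    have hτI : τ ∈ Icc s T :=
      ⟨le_csInf ⟨t₁, ht₁⟩ fun t ht => ht.1.1, (csInf_le hBb ht₁).trans ht₁.1.2⟩
    have hin : ∀ u ∈ Ico s τ, p u ∈ Ω := by
      intro u hu
      by_contra hnot
      have : τ ≤ u := csInf_le hBb ⟨⟨hu.1, hu.2.le.trans hτI.2⟩, hnot⟩
      exact absurd hu.2 (not_lt.2 this)
    have hτΩ := hclosed τ hτI hin
    by_cases hex : ∃ r ∈ Icc s T, τ < r ∧ IntervalIntegrable (fun u => F u (p u)) volume s r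
    · obtain ⟨r, hr, hτr, hri⟩ := hex
      have hc := hcont r hr hri τ ⟨hτI.1, hτr.le⟩
      have hev := hc (hΩ.mem_nhds hτΩ)
      obtain ⟨δ, hδ, hball⟩ := Metric.mem_nhdsWithin_iff.1 hev
      have hlt : τ < min r (τ + δ) := lt_min hτr (by linarith)
      obtain ⟨t, htB, htlt⟩ := exists_lt_of_csInf_lt ⟨t₁, ht₁⟩ hlt
      have hτt : τ ≤ t := csInf_le hBb htB
      apply htB.2
      apply hball
      refine ⟨?_, htB.1.1, (htlt.trans_le (min_le_left _ _)).le⟩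
      rw [Metric.mem_ball, Real.dist_eq, abs_of_nonneg (by linarith)]
      have := htlt.trans_le (min_le_right _ _)
      linarith
    · push Not at hex
      have hτt : τ ≤ t₁ := csInf_le hBb ht₁
      rcases hτt.eq_or_lt with h | h
      · exact ht₁.2 (h ▸ hτΩ)
      · have hu := hex t₁ ht₁.1 h
        apply ht₁.2
        rw [hp t₁ ht₁.1, intervalIntegral.integral_undef hu, add_zero]
        exact hx
  have hi := hint T ⟨hsT, le_rfl⟩ fun u hu => hall u ⟨hu.1, hu.2.le⟩
  exact ⟨hall, hi, hcont T ⟨hsT, le_rfl⟩ hi⟩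

lemma aux_fwd {d : ℕ} {Ω : Set (Euc d)} (hΩ : IsOpen Ω) {F G : ℝ → Euc d → Euc d}
    {a b δ : ℝ → ℝ}
    (HF : FieldOK Ω F a) (HG : FieldOK Ω G b) {s T : ℝ} (hsT : s ≤ T)
    (ha : IntervalIntegrable a volume s T) (hb : IntervalIntegrable b volume s T)
    (hδ : IntervalIntegrable δ volume s T) (hFG : ∀ u, ∀ y ∈ Ω, ‖F u y - G u y‖ ≤ δ u)
    (hδ0 : ∀ u, 0 ≤ δ u)
    {p q : ℝ → Euc d} {x : Euc d} (hx : x ∈ Ω)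
    (hp : ∀ t ∈ Icc s T, p t = x + ∫ u in s..t, F u (p u))
    (hq : ∀ t ∈ Icc s T, q t = x + ∫ u in s..t, G u (q u)) :
    ‖p T - q T‖ ≤ (∫ u in s..T, δ u) * Real.exp (∫ u in s..T, a u) := by
  obtain ⟨p1, p2, p3⟩ := aux_stay hΩ HF hsT ha hx hp
  obtain ⟨q1, q2, q3⟩ := aux_stay hΩ HG hsT hb hx hq
  have hyc : ContinuousOn (fun t => ‖p t - q t‖) (Icc s T) := (p3.sub q3).norm
  have hres : ∀ {E : Type} [NormedAddCommGroup E] {f : ℝ → E} {t : ℝ},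
      t ∈ Icc s T → IntervalIntegrable f volume s T → IntervalIntegrable f volume s t := by
    intro E _ f t ht hf
    apply hf.mono_set; rw [uIcc_of_le ht.1, uIcc_of_le hsT]; exact Icc_subset_Icc_right ht.2
  have hay : IntervalIntegrable (fun u => a u * ‖p u - q u‖) volume s T :=
    ha.mul_continuousOn (by rwa [uIcc_of_le hsT])
  refine aux_gronwall s T (∫ u in s..T, δ u) hsT a (fun t => ‖p t - q t‖) HF.nonneg ha hyc ?_
  intro t ht
  have e1 : p t - q t = ∫ u in s..t, (F u (p u) - G u (q u)) := by
    rw [intervalIntegral.integral_sub (hres ht p2) (hres ht q2), hp t ht, hq t ht]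
    abel
  show ‖p t - q t‖ ≤ _
  have h1 : ‖p t - q t‖ ≤ ∫ u in s..t, (δ u + a u * ‖p u - q u‖) := by
    rw [e1]
    apply intervalIntegral.norm_integral_le_of_norm_le ht.1
    · refine Eventually.of_forall fun u hu => ?_
      have huI : u ∈ Icc s T := ⟨hu.1.le, hu.2.trans ht.2⟩
      have h2 := hFG u (q u) (q1 u huI)
      have h3 := HF.lip u (p u) (q u)
      rw [indicator_of_mem (p1 u huI), indicator_of_mem (q1 u huI)] at h3
      have h4 := norm_add_le (F u (q u) - G u (q u)) (F u (p u) - F u (q u))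
      have h5 : F u (q u) - G u (q u) + (F u (p u) - F u (q u)) = F u (p u) - G u (q u) := by abel
      rw [h5] at h4
      linarith
    · exact (hres ht hδ).add (hres ht hay)
  rw [intervalIntegral.integral_add (hres ht hδ) (hres ht hay)] at h1
  have h2 : ∫ u in s..t, δ u ≤ ∫ u in s..T, δ u :=
    intervalIntegral.integral_mono_interval le_rfl ht.1 ht.2
      (Eventually.of_forall hδ0) hδ
  linarith

lemma aux_bwd {d : ℕ} {Ω : Set (Euc d)} (hΩ : IsOpen Ω) {F G : ℝ → Euc d → Euc d}
    {a b δ : ℝ → ℝ}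
    (HF : FieldOK Ω F a) (HG : FieldOK Ω G b) {s T : ℝ} (hsT : T ≤ s)
    (ha : IntervalIntegrable a volume T s) (hb : IntervalIntegrable b volume T s)
    (hδ : IntervalIntegrable δ volume T s) (hFG : ∀ u, ∀ y ∈ Ω, ‖F u y - G u y‖ ≤ δ u)
    (hδ0 : ∀ u, 0 ≤ δ u)
    {p q : ℝ → Euc d} {x : Euc d} (hx : x ∈ Ω)
    (hp : ∀ t ∈ Icc T s, p t = x + ∫ u in s..t, F u (p u))
    (hq : ∀ t ∈ Icc T s, q t = x + ∫ u in s..t, G u (q u)) :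
    ‖p T - q T‖ ≤ (∫ u in T..s, δ u) * Real.exp (∫ u in T..s, a u) := by
  have hneg : ∀ {F : ℝ → Euc d → Euc d} {a : ℝ → ℝ}, FieldOK Ω F a →
      FieldOK Ω (fun u y => - F (-u) y) (fun u => a (-u)) := by
    intro F a H
    refine ⟨fun u => H.nonneg _, fun u y hy => by simpa using H.bdd (-u) y hy, ?_, ?_⟩
    · intro u y z
      have h1 : ∀ y, indicator Ω (fun y => - F (-u) y) y = - indicator Ω (F (-u)) y := by
        intro y
        by_cases hy : y ∈ Ω <;> simp [hy]
      rw [h1, h1, neg_sub_neg, norm_sub_rev]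
      exact H.lip (-u) y z
    · intro y hy
      exact ((H.meas y hy).comp measurable_neg).neg
  have hsol : ∀ {F : ℝ → Euc d → Euc d} {p : ℝ → Euc d},
      (∀ t ∈ Icc T s, p t = x + ∫ u in s..t, F u (p u)) →
      ∀ t ∈ Icc (-s) (-T), p (-t) = x + ∫ u in (-s)..t, - F (-u) (p (-u)) := by
    intro F p hp t ht
    rw [hp (-t) ⟨by linarith [ht.2], by linarith [ht.1]⟩, intervalIntegral.integral_neg,
      intervalIntegral.integral_comp_neg (fun u => F u (p u)), neg_neg,
      intervalIntegral.integral_symm]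
  have := aux_fwd hΩ (hneg HF) (hneg HG) (s := -s) (T := -T) (δ := fun u => δ (-u)) (by linarith)
    ((IntervalIntegrable.iff_comp_neg).1 ha.symm) ((IntervalIntegrable.iff_comp_neg).1 hb.symm)
    ((IntervalIntegrable.iff_comp_neg).1 hδ.symm)
    (fun u y hy => by
      rw [neg_sub_neg, norm_sub_rev]; exact hFG (-u) y hy) (fun u => hδ0 _) hx
    (p := fun u => p (-u)) (q := fun u => q (-u)) (hsol hp) (hsol hq)
  rw [intervalIntegral.integral_comp_neg δ, intervalIntegral.integral_comp_neg a] at this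
  simpa using this

lemma aux_ext_cont {d : ℕ} {W : Type*} [NormedAddCommGroup W] {Ω : Set (Euc d)} (hΩ : IsOpen Ω)
    (h : Euc d → W) (hc : ContinuousOn h Ω)
    (hf : ∀ x ∈ frontier Ω, Tendsto h (𝓝[Ω] x) (𝓝 0)) : Continuous (indicator Ω h) := by
  rw [continuous_iff_continuousAt]
  intro x
  by_cases hx : x ∈ Ω
  · have h1 : ContinuousAt h x := hc.continuousAt (hΩ.mem_nhds hx)
    apply h1.congr
    filter_upwards [hΩ.mem_nhds hx] with y hy
    exact (indicator_of_mem hy _).symm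
  · by_cases hxc : x ∈ closure Ω
    · have hfr : x ∈ frontier Ω := by
        rw [hΩ.frontier_eq]; exact ⟨hxc, hx⟩
      rw [ContinuousAt, indicator_of_notMem hx, ← nhdsWithin_univ, ← union_compl_self Ω,
        nhdsWithin_union]
      refine Tendsto.sup ?_ ?_
      · refine (hf x hfr).congr' ?_
        filter_upwards [self_mem_nhdsWithin] with y hy
        exact (indicator_of_mem hy _).symm
      · refine tendsto_const_nhds.congr' ?_
        filter_upwards [self_mem_nhdsWithin] with y hy
        exact (indicator_of_notMem hy _).symm
    · have h1 : ContinuousAt (fun _ : Euc d => (0 : W)) x := continuousAt_const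
      apply h1.congr
      filter_upwards [isClosed_closure.isOpen_compl.mem_nhds hxc] with y hy
      exact (indicator_of_notMem (fun hy' => hy (subset_closure hy')) _).symm

lemma aux_ext_bdd {d : ℕ} {W : Type*} [NormedAddCommGroup W] {Ω : Set (Euc d)} (hΩ : IsOpen Ω)
    (hb : Bornology.IsBounded Ω)
    (h : Euc d → W) (hc : ContinuousOn h Ω)
    (hf : ∀ x ∈ frontier Ω, Tendsto h (𝓝[Ω] x) (𝓝 0)) :
    (0 ≤ ⨆ x ∈ Ω, ‖h x‖) ∧ ∀ x ∈ Ω, ‖h x‖ ≤ ⨆ x ∈ Ω, ‖h x‖ := by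
  have hn : 0 ≤ ⨆ x ∈ Ω, ‖h x‖ :=
    Real.iSup_nonneg fun x => Real.iSup_nonneg fun _ => norm_nonneg _
  refine ⟨hn, ?_⟩
  obtain ⟨C, hC⟩ := hb.isCompact_closure.exists_bound_of_continuousOn
    (aux_ext_cont hΩ h hc hf).continuousOn
  have hC' : ∀ x ∈ Ω, ‖h x‖ ≤ C := by
    intro x hx
    have := hC x (subset_closure hx)
    rwa [indicator_of_mem hx] at this
  intro x hx
  have hbd : BddAbove (range fun x => ⨆ (_ : x ∈ Ω), ‖h x‖) := by
    refine ⟨max C 0, ?_⟩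
    rintro _ ⟨y, rfl⟩
    by_cases hy : y ∈ Ω
    · simp only [hy, ciSup_unique]
      exact (hC' y hy).trans (le_max_left _ _)
    · simp [hy]
  have := le_ciSup hbd x
  simpa only [hx, ciSup_unique] using this

lemma aux_C1 {d : ℕ} {Ω : Set (Euc d)} (hΩ : IsOpen Ω) (hb : Bornology.IsBounded Ω)
    (f : Euc d → Euc d) (L : ℝ) (hm : MemC0k 1 Ω f) (hL : CknormOn 1 Ω f ≤ L) :
    (∀ y ∈ Ω, ‖f y‖ ≤ L) ∧ (∀ y ∈ Ω, ‖fderiv ℝ f y‖ ≤ L) ∧ Continuous (indicator Ω f) := by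
  obtain ⟨hcd, hfr⟩ := hm
  have hcj : ∀ j : ℕ, j ≤ 1 → ContinuousOn (iteratedFDeriv ℝ j f) Ω := by
    intro j hj
    have h1 := hcd.continuousOn_iteratedFDerivWithin (m := j) (by exact_mod_cast hj) hΩ.uniqueDiffOn
    exact h1.congr fun x hx => (iteratedFDerivWithin_of_isOpen j hΩ hx).symm
  obtain ⟨n0, h0⟩ := aux_ext_bdd hΩ hb _ (hcj 0 (by norm_num)) (hfr 0 (by norm_num))
  obtain ⟨n1, h1⟩ := aux_ext_bdd hΩ hb _ (hcj 1 le_rfl) (hfr 1 le_rfl)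
  have hsum : (⨆ x ∈ Ω, ‖iteratedFDeriv ℝ 0 f x‖) + (⨆ x ∈ Ω, ‖iteratedFDeriv ℝ 1 f x‖) ≤ L := by
    have := hL
    rw [CknormOn, Finset.sum_range_succ, Finset.sum_range_one] at this
    exact this
  refine ⟨?_, ?_, ?_⟩
  · intro y hy
    have := h0 y hy
    rw [norm_iteratedFDeriv_zero] at this
    linarith
  · intro y hy
    have := h1 y hy
    rw [norm_iteratedFDeriv_one] at this
    linarith
  · apply aux_ext_cont hΩ f hcd.continuousOn
    intro x hx
    have := hfr 0 (by norm_num) x hx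
    rw [tendsto_zero_iff_norm_tendsto_zero] at this ⊢
    simpa only [norm_iteratedFDeriv_zero] using this

lemma aux_lip {d : ℕ} {Ω : Set (Euc d)} (hΩ : IsOpen Ω)
    (f : Euc d → Euc d) (L : ℝ) (hL0 : 0 ≤ L) (hd : DifferentiableOn ℝ f Ω)
    (hL : ∀ y ∈ Ω, ‖fderiv ℝ f y‖ ≤ L) (hc : Continuous (indicator Ω f)) (y z : Euc d) :
    ‖indicator Ω f y - indicator Ω f z‖ ≤ L * ‖y - z‖ := by
  -- mean value along the segment
  have hmv : ∀ y z : Euc d, ∀ τ ∈ Icc (0:ℝ) 1, (∀ r ∈ Ico (0:ℝ) τ, y + r • (z - y) ∈ Ω) →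
      ‖indicator Ω f (y + τ • (z - y)) - indicator Ω f y‖ ≤ L * ‖z - y‖ := by
    intro y z τ hτ hin
    have hγ : Continuous fun r : ℝ => y + r • (z - y) := by fun_prop
    have := norm_image_sub_le_of_norm_deriv_right_le_segment
      (f := fun r : ℝ => indicator Ω f (y + r • (z - y)))
      (f' := fun r : ℝ => fderiv ℝ f (y + r • (z - y)) (z - y)) (a := 0) (b := τ)
      (C := L * ‖z - y‖) (hc.comp hγ).continuousOn
      (by
        intro r hr
        have h1 := hin r hr
        have h2 : HasFDerivAt f (fderiv ℝ f (y + r • (z - y))) (y + r • (z - y)) :=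
          (hd.differentiableAt (hΩ.mem_nhds h1)).hasFDerivAt
        have h3 : HasDerivAt (fun r : ℝ => y + r • (z - y)) (z - y) r := by
          simpa using ((hasDerivAt_id r).smul_const (z - y)).const_add y
        have h4 := h2.comp_hasDerivAt r h3
        have h5 : HasDerivAt (fun r : ℝ => indicator Ω f (y + r • (z - y)))
            (fderiv ℝ f (y + r • (z - y)) (z - y)) r := by
          apply h4.congr_of_eventuallyEq
          filter_upwards [(hΩ.preimage hγ).mem_nhds h1] with u hu
          have hu2 : y + u • (z - y) ∈ Ω := hu
          simp [indicator_of_mem hu2]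
        exact h5.hasDerivWithinAt)
      (by
        intro r hr
        exact (ContinuousLinearMap.le_opNorm _ _).trans
          (mul_le_mul_of_nonneg_right (hL _ (hin r hr)) (norm_nonneg _)))
      τ ⟨hτ.1, le_rfl⟩
    simp only [zero_smul, add_zero, sub_zero] at this
    refine this.trans ?_
    have h0 : 0 ≤ L * ‖z - y‖ := by positivity
    nlinarith [hτ.2]
  have hout : ∀ y z : Euc d, y ∈ Ω → z ∉ Ω → ‖f y‖ ≤ L * ‖y - z‖ := by
    intro y z hy hz
    have hγ : Continuous fun r : ℝ => y + r • (z - y) := by fun_prop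
    set B : Set ℝ := Icc 0 1 ∩ (fun r : ℝ => y + r • (z - y)) ⁻¹' Ωᶜ with hB
    have hBc : IsCompact B := isCompact_Icc.inter_right (hΩ.isClosed_compl.preimage hγ)
    have hBne : B.Nonempty := ⟨1, ⟨by norm_num, le_rfl⟩, by simpa using hz⟩
    have hmem := hBc.sInf_mem hBne
    have hin : ∀ r ∈ Ico (0:ℝ) (sInf B), y + r • (z - y) ∈ Ω := by
      intro r hr
      by_contra hn
      have : sInf B ≤ r := csInf_le hBc.bddBelow ⟨⟨hr.1, hr.2.le.trans hmem.1.2⟩, hn⟩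
      exact absurd hr.2 (not_lt.2 this)
    have := hmv y z _ hmem.1 hin
    rw [indicator_of_notMem hmem.2, indicator_of_mem hy, zero_sub, norm_neg, norm_sub_rev z y] at this
    exact this
  by_cases hy : y ∈ Ω <;> by_cases hz : z ∈ Ω
  · by_cases hseg : ∀ r ∈ Icc (0:ℝ) 1, y + r • (z - y) ∈ Ω
    · have := hmv y z 1 ⟨by norm_num, le_rfl⟩ fun r hr => hseg r ⟨hr.1, hr.2.le⟩
      rw [norm_sub_rev, norm_sub_rev y z]
      simpa using this
    · push Not at hseg
      obtain ⟨r, hr, hn⟩ := hseg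
      have h1 := hout y _ hy hn
      have h2 := hout z _ hz hn
      have e1 : y - (y + r • (z - y)) = r • (y - z) := by module
      have e2 : z - (y + r • (z - y)) = (-(1 - r)) • (y - z) := by module
      rw [e1, norm_smul, Real.norm_of_nonneg hr.1] at h1
      rw [e2, norm_smul, norm_neg, Real.norm_of_nonneg (by linarith [hr.2])] at h2
      rw [indicator_of_mem hy, indicator_of_mem hz]
      have := norm_sub_le (f y) (f z)
      nlinarith
  · rw [indicator_of_mem hy, indicator_of_notMem hz, sub_zero]
    exact hout y z hy hz
  · rw [indicator_of_mem hz, indicator_of_notMem hy, zero_sub, norm_neg, norm_sub_rev]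
    exact hout z y hz hy
  · rw [indicator_of_notMem hy, indicator_of_notMem hz, sub_zero, norm_zero]
    positivity

lemma aux_CS (g : ℝ → ℝ) (hg : IntervalIntegrable g volume 0 1)
    (hg2 : IntervalIntegrable (fun u => g u ^ 2) volume 0 1) :
    ∫ u in (0:ℝ)..1, g u ≤ Real.sqrt (∫ u in (0:ℝ)..1, g u ^ 2) := by
  apply Real.le_sqrt_of_sq_le
  set m := ∫ u in (0:ℝ)..1, g u with hm
  have h0 : 0 ≤ ∫ u in (0:ℝ)..1, (g u - m) ^ 2 :=
    intervalIntegral.integral_nonneg (by norm_num) fun u _ => sq_nonneg _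
  have h1 : ∀ u, (g u - m) ^ 2 = (g u ^ 2 - (2 * m) * g u) + m ^ 2 := fun u => by ring
  simp_rw [h1] at h0
  rw [intervalIntegral.integral_add (hg2.sub (hg.const_mul _)) (by simp),
    intervalIntegral.integral_sub hg2 (hg.const_mul _), intervalIntegral.integral_const_mul,
    ← hm] at h0
  simp at h0
  nlinarith

lemma aux_L1 {V : Type*} [NormedAddCommGroup V] (v : ℝ → V) (hv : StronglyMeasurable v)
    (h2 : IntegrableOn (fun t => ‖v t‖ ^ 2) (Icc (0:ℝ) 1)) :
    IntervalIntegrable (fun t => ‖v t‖) volume 0 1 := by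
  rw [intervalIntegrable_iff_integrableOn_Icc_of_le (by norm_num)]
  have hc : IntegrableOn (fun _ : ℝ => (1:ℝ)) (Icc (0:ℝ) 1) := by simp
  refine Integrable.mono' (hc.add h2) hv.norm.aestronglyMeasurable ?_
  refine Eventually.of_forall fun t => ?_
  simp only [norm_norm, Pi.add_apply]
  nlinarith [sq_nonneg (‖v t‖ - 1), norm_nonneg (v t)]

/-- sup-norm stability of the flow in the vector field:
`‖φ^v_{st} − φ^w_{st}‖_∞ ≤ c‖v − w‖_{V^{[0,1]}} exp(c‖v‖_{V^{[0,1]}})`, the constant `c`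
(the embedding constant) not depending on `v, w, s, t`. -/
theorem stmt_7 {d : ℕ} (Ω : Set (Euc d)) (hΩo : IsOpen Ω) (hΩb : Bornology.IsBounded Ω)
    (V : Type*) [NormedAddCommGroup V] [InnerProductSpace ℝ V] [CompleteSpace V]
    [MeasurableSpace V] [BorelSpace V]
    (ι : V →ₗ[ℝ] (Euc d → Euc d)) (hinj : Function.Injective ι)
    (c : ℝ) (hc : 0 < c)
    (hemb : ∀ f : V, MemC0k 1 Ω (ι f) ∧ CknormOn 1 Ω (ι f) ≤ c * ‖f‖)
    (Φ : (ℝ → V) → ℝ → ℝ → Euc d → Euc d)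
    (hflow : ∀ v : ℝ → V, InV01 v → ∀ s ∈ Icc (0:ℝ) 1, ∀ t ∈ Icc (0:ℝ) 1, ∀ x ∈ Ω,
      Φ v s t x = x + ∫ u in s..t, ι (v u) (Φ v s u x)) :
    ∀ v w : ℝ → V, InV01 v → InV01 w →
      ∀ s ∈ Icc (0:ℝ) 1, ∀ t ∈ Icc (0:ℝ) 1,
        (⨆ x ∈ Ω, ‖Φ v s t x - Φ w s t x‖)
          ≤ c * normV01 (fun u => v u - w u) * Real.exp (c * normV01 v) := by
  classical
  intro v w hv hw s hs t ht
  have hvs := aux_stronglyMeasurable v hv.1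
  have hws := aux_stronglyMeasurable w hw.1
  have hOK : ∀ v : ℝ → V, InV01 v → FieldOK Ω (fun u => ι (v u)) (fun u => c * ‖v u‖) := by
    intro v hv
    refine ⟨fun u => by positivity, ?_, ?_, ?_⟩
    · intro u y hy
      exact (aux_C1 hΩo hΩb _ _ (hemb (v u)).1 (hemb (v u)).2).1 y hy
    · intro u y z
      obtain ⟨_, h2, h3⟩ := aux_C1 hΩo hΩb _ _ (hemb (v u)).1 (hemb (v u)).2
      exact aux_lip hΩo _ _ (by positivity)
        ((hemb (v u)).1.1.differentiableOn (by norm_num)) h2 h3 y z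
    · intro y hy
      let ev : V →ₗ[ℝ] Euc d := (LinearMap.proj y) ∘ₗ ι
      have hcont : Continuous ev := (ev.mkContinuous c fun f =>
        (aux_C1 hΩo hΩb _ _ (hemb f).1 (hemb f).2).1 y hy).continuous
      exact hcont.measurable.comp hv.1
  have hd2 : IntegrableOn (fun t => ‖v t - w t‖ ^ 2) (Icc (0:ℝ) 1) := by
    refine Integrable.mono' ((hv.2.const_mul 2).add (hw.2.const_mul 2))
      ((hvs.sub hws).norm.pow 2).aestronglyMeasurable ?_
    refine Eventually.of_forall fun u => ?_
    simp only [Pi.add_apply]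
    rw [Real.norm_of_nonneg (by positivity)]
    have h1 := norm_sub_le (v u) (w u)
    have h0 := norm_nonneg (v u - w u)
    nlinarith [sq_nonneg (‖v u‖ - ‖w u‖)]
  have hiv := aux_L1 v hvs hv.2
  have hiw := aux_L1 w hws hw.2
  have hid := aux_L1 (fun u => v u - w u) (hvs.sub hws) hd2
  have hsq : ∀ {g : ℝ → ℝ}, IntegrableOn g (Icc (0:ℝ) 1) → IntervalIntegrable g volume 0 1 :=
    fun h => (intervalIntegrable_iff_integrableOn_Icc_of_le (by norm_num)).2 h
  have hmono : ∀ g : ℝ → ℝ, (∀ u, 0 ≤ g u) → IntervalIntegrable g volume 0 1 →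
      IntervalIntegrable (fun u => g u ^ 2) volume 0 1 → ∀ p ∈ Icc (0:ℝ) 1, ∀ q ∈ Icc (0:ℝ) 1,
      p ≤ q → IntervalIntegrable (fun u => c * g u) volume p q ∧
        ∫ u in p..q, c * g u ≤ c * Real.sqrt (∫ u in (0:ℝ)..1, g u ^ 2) := by
    intro g hg0 hg hg2 p hp q hq hpq
    constructor
    · refine (hg.const_mul c).mono_set ?_
      rw [uIcc_of_le hpq, uIcc_of_le zero_le_one]
      exact Icc_subset_Icc hp.1 hq.2
    · rw [intervalIntegral.integral_const_mul]
      refine mul_le_mul_of_nonneg_left ?_ hc.le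
      refine le_trans ?_ (aux_CS g hg hg2)
      exact intervalIntegral.integral_mono_interval hp.1 hpq hq.2 (Eventually.of_forall hg0) hg
  have Mv := hmono _ (fun u => norm_nonneg (v u)) hiv (hsq hv.2)
  have Mw := hmono _ (fun u => norm_nonneg (w u)) hiw (hsq hw.2)
  have Md := hmono _ (fun u => norm_nonneg (v u - w u)) hid (hsq hd2)
  have hFG : ∀ u, ∀ y ∈ Ω, ‖ι (v u) y - ι (w u) y‖ ≤ c * ‖v u - w u‖ := by
    intro u y hy
    have := (aux_C1 hΩo hΩb _ _ (hemb (v u - w u)).1 (hemb (v u - w u)).2).1 y hy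
    rwa [map_sub, Pi.sub_apply] at this
  have hR : 0 ≤ c * normV01 (fun u => v u - w u) * Real.exp (c * normV01 v) := by
    have : 0 ≤ normV01 (fun u => v u - w u) := Real.sqrt_nonneg _
    positivity
  refine Real.iSup_le (fun x => Real.iSup_le (fun hx => ?_) hR) hR
  have hfin : ∀ P Q : ℝ, P ≤ c * normV01 (fun u => v u - w u) → Q ≤ c * normV01 v →
      P * Real.exp Q ≤ c * normV01 (fun u => v u - w u) * Real.exp (c * normV01 v) := by
    intro P Q hP hQ
    have : 0 ≤ normV01 (fun u => v u - w u) := Real.sqrt_nonneg _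
    exact mul_le_mul hP (Real.exp_le_exp.2 hQ) (Real.exp_pos _).le (by positivity)
  rcases le_total s t with hst | hst
  · refine (aux_fwd hΩo (hOK v hv) (hOK w hw) hst (Mv s hs t ht hst).1 (Mw s hs t ht hst).1
      (Md s hs t ht hst).1 hFG (fun u => by positivity) hx
      (p := fun u => Φ v s u x) (q := fun u => Φ w s u x)
      (fun r hr => hflow v hv s hs r ⟨hs.1.trans hr.1, hr.2.trans ht.2⟩ x hx)
      (fun r hr => hflow w hw s hs r ⟨hs.1.trans hr.1, hr.2.trans ht.2⟩ x hx)).trans ?_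
    exact hfin _ _ (Md s hs t ht hst).2 (Mv s hs t ht hst).2
  · refine (aux_bwd hΩo (hOK v hv) (hOK w hw) hst (Mv t ht s hs hst).1 (Mw t ht s hs hst).1
      (Md t ht s hs hst).1 hFG (fun u => by positivity) hx
      (p := fun u => Φ v s u x) (q := fun u => Φ w s u x)
      (fun r hr => hflow v hv s hs r ⟨ht.1.trans hr.1, hr.2.trans hs.2⟩ x hx)
      (fun r hr => hflow w hw s hs r ⟨ht.1.trans hr.1, hr.2.trans hs.2⟩ x hx)).trans ?_
    exact hfin _ _ (Md t ht s hs hst).2 (Mv t ht s hs hst).2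
end
end
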